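/- arXiv:2106.03335 — 7 statements merged into one kernel-verified Lean document; each statement's English description precedes it below -/
import Mathlib

section
/- For every ε > 0 and every K > 0 there exists t₀(ε,K) such that the following holds for every integer t ≥ t₀(ε,K): if (n,m) is a pair of integers with 1 ≤ m ≤ n/2 and C(n,m) = t, then there is at most one pair of integers (n',m') ≠ (n,m) with 1 ≤ m' ≤ n'/2, C(n',m') = t, m' < m, n' > n, and |m − m'| + |n − n'| ≤ K·exp((log log t)^{1−ε}). -/
/-- Passing from row `n` to row `n + a` and from column `m + b` to column `m` multiplies the
binomial coefficient by a quotient of rising factorials. -/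
lemma choose_mul_ascFactorial_shift (z m a b : ℕ) :
    (z + m + b + a).choose m * (z + 1).ascFactorial (a + b) =
      (z + m + b).choose (m + b) *
        ((z + m + b + 1).ascFactorial a * (m + 1).ascFactorial b) := by
  have h1 : (z + m + b + a).choose m * m.factorial * (z + (a + b)).factorial =
      (z + m + b + a).factorial := by
    have := Nat.choose_mul_factorial_mul_factorial (show m ≤ z + m + b + a by omega)
    rwa [show z + m + b + a - m = z + (a + b) by omega] at this
  have h2 : (z + m + b).choose (m + b) * (m + b).factorial * z.factorial =
      (z + m + b).factorial := by
    have := Nat.choose_mul_factorial_mul_factorial (show m + b ≤ z + m + b by omega)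
    rwa [show z + m + b - (m + b) = z by omega] at this
  rw [← Nat.factorial_mul_ascFactorial (z + m + b) a, ← h2,
    ← Nat.factorial_mul_ascFactorial m b, ← Nat.factorial_mul_ascFactorial z (a + b)] at h1
  have hpos : 0 < m.factorial * z.factorial := by positivity
  apply Nat.eq_of_mul_eq_mul_left hpos
  linarith

lemma ascFactorial_mul_pow_le {n z : ℕ} (h : z ≤ n) (a : ℕ) :
    (n + 1).ascFactorial a * z ^ a ≤ n ^ a * (z + 1).ascFactorial a := by
  induction a with
  | zero => simp
  | succ a ih =>
    have hstep : (n + 1 + a) * z ≤ n * (z + 1 + a) := by nlinarith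
    rw [Nat.ascFactorial_succ, Nat.ascFactorial_succ, pow_succ, pow_succ]
    calc _ = ((n + 1 + a) * z) * ((n + 1).ascFactorial a * z ^ a) := by ring
      _ ≤ (n * (z + 1 + a)) * (n ^ a * (z + 1).ascFactorial a) := Nat.mul_le_mul hstep ih
      _ = _ := by ring

lemma ascFactorial_add_mul_ascFactorial_le {n z : ℕ} (h : z ≤ n) (p q k : ℕ) :
    (n + p).ascFactorial k * z.ascFactorial k ≤
      n.ascFactorial k * (z + p + q).ascFactorial k := by
  induction k with
  | zero => simp
  | succ k ih =>
    have hstep : (n + p + k) * (z + k) ≤ (n + k) * (z + p + q + k) := by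
      nlinarith [Nat.mul_le_mul_left p h, Nat.zero_le (n * q), Nat.zero_le (k * q)]
    simp only [Nat.ascFactorial_succ]
    calc _ = ((n + p + k) * (z + k)) * ((n + p).ascFactorial k * z.ascFactorial k) := by ring
      _ ≤ ((n + k) * (z + p + q + k)) * (n.ascFactorial k * (z + p + q).ascFactorial k) :=
        Nat.mul_le_mul hstep ih
      _ = _ := by ring

lemma ascFactorial_mono_left {x y : ℕ} (h : x ≤ y) (k : ℕ) :
    x.ascFactorial k ≤ y.ascFactorial k := by
  induction k with
  | zero => simp
  | succ k ih =>
    simp only [Nat.ascFactorial_succ]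
    exact Nat.mul_le_mul (by omega) ih

lemma ascFactorial_succ_lt_of_lt {x y : ℕ} (h : x < y) {k : ℕ} (hk : 0 < k) :
    (x + 1).ascFactorial k < (y + 1).ascFactorial k := by
  obtain ⟨k, rfl⟩ := Nat.exists_eq_succ_of_ne_zero hk.ne'
  simp only [Nat.succ_eq_add_one, Nat.ascFactorial_succ]
  exact Nat.mul_lt_mul_of_lt_of_le (by omega) (ascFactorial_mono_left (by omega) k)
    (Nat.ascFactorial_pos y k)

/-- Along a line of direction `(p, -q)`, once the binomial coefficients stop increasing they
strictly decrease. -/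
lemma choose_lt_of_choose_le (z m p q : ℕ) (hq : 0 < q)
    (h : (z + m + q + q + p).choose (m + q) ≤ (z + m + q + q).choose (m + q + q)) :
    (z + m + q + q + p + p).choose m < (z + m + q + q + p).choose (m + q) := by
  have e0 := choose_mul_ascFactorial_shift z (m + q) p q
  have e1 := choose_mul_ascFactorial_shift (z + (p + q)) m p q
  rw [show z + (m + q) + q = z + m + q + q by ring] at e0
  rw [show z + (p + q) + m + q = z + m + q + q + p by ring] at e1
  have hB : (m + 1).ascFactorial q < (m + q + 1).ascFactorial q :=
    ascFactorial_succ_lt_of_lt (by omega) hq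
  have hAC : (z + m + q + q + p + 1).ascFactorial p * (z + 1).ascFactorial (p + q) ≤
      (z + m + q + q + 1).ascFactorial p * (z + (p + q) + 1).ascFactorial (p + q) := by
    have h1 := ascFactorial_add_mul_ascFactorial_le
      (show z + 1 ≤ z + m + q + q + 1 by omega) p q p
    have h2 : (z + 1 + p).ascFactorial q ≤ (z + 1 + p + q + p).ascFactorial q :=
      ascFactorial_mono_left (by omega) q
    rw [← Nat.ascFactorial_mul_ascFactorial (z + 1) p q,
      ← Nat.ascFactorial_mul_ascFactorial (z + (p + q) + 1) p q,
      show z + m + q + q + p + 1 = z + m + q + q + 1 + p by ring,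
      show z + (p + q) + 1 = z + 1 + p + q by ring]
    calc _ = ((z + m + q + q + 1 + p).ascFactorial p * (z + 1).ascFactorial p) *
          (z + 1 + p).ascFactorial q := by ring
      _ ≤ _ := Nat.mul_le_mul h1 h2
      _ = _ := by ring
  have hA1 : 0 < (z + m + q + q + p + 1).ascFactorial p := Nat.ascFactorial_pos _ _
  have hC0 : 0 < (z + 1).ascFactorial (p + q) := Nat.ascFactorial_pos _ _
  have hC1 : 0 < (z + (p + q) + 1).ascFactorial (p + q) := Nat.ascFactorial_pos _ _
  have hf0 : 0 < (z + m + q + q).choose (m + q + q) := Nat.choose_pos (by omega)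
  have hf1 : 0 < (z + m + q + q + p).choose (m + q) := Nat.choose_pos (by omega)
  generalize (z + m + q + q + p + p).choose m = f2 at *
  generalize (z + m + q + q + p).choose (m + q) = f1 at *
  generalize (z + m + q + q).choose (m + q + q) = f0 at *
  generalize (z + m + q + q + p + 1).ascFactorial p = A1 at *
  generalize (z + m + q + q + 1).ascFactorial p = A0 at *
  generalize (z + 1).ascFactorial (p + q) = C0 at *
  generalize (z + (p + q) + 1).ascFactorial (p + q) = C1 at *
  generalize (m + 1).ascFactorial q = B1 at *
  generalize (m + q + 1).ascFactorial q = B0 at *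
  have hAB0 : A0 * B0 ≤ C0 := by
    refine Nat.le_of_mul_le_mul_left ?_ hf0
    rw [← e0]
    exact Nat.mul_le_mul_right _ h
  have hAB1 : A1 * B1 < C1 := by
    refine Nat.lt_of_mul_lt_mul_left (a := C0) ?_
    calc C0 * (A1 * B1) < C0 * (A1 * B0) := by gcongr
      _ = (A1 * C0) * B0 := by ring
      _ ≤ (A0 * C1) * B0 := Nat.mul_le_mul_right _ hAC
      _ = (A0 * B0) * C1 := by ring
      _ ≤ C0 * C1 := Nat.mul_le_mul_right _ hAB0
  refine Nat.lt_of_mul_lt_mul_right (a := C1) ?_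
  rw [e1]
  exact Nat.mul_lt_mul_of_pos_left hAB1 hf1

/-- Three equally valued entries of Pascal's triangle do not lie on a line of direction
`(p, -q)`. -/
lemma not_three_collinear {n m p q i j : ℕ} (hq : 0 < q) (hi : 0 < i) (hij : i < j)
    (hm : j * q ≤ m) (hmn : m ≤ n)
    (h1 : (n + i * p).choose (m - i * q) = n.choose m)
    (h2 : (n + j * p).choose (m - j * q) = n.choose m) : False := by
  set f : ℕ → ℕ := fun s => (n + s * p).choose (m - s * q) with hf
  have key : ∀ s, s + 2 ≤ j → f (s + 1) ≤ f s → f (s + 2) < f (s + 1) := by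
    intro s hs hle
    have hsm : (s + 2) * q ≤ m := (Nat.mul_le_mul_right q hs).trans hm
    obtain ⟨m', rfl⟩ := Nat.exists_eq_add_of_le hsm
    obtain ⟨z, rfl⟩ := Nat.exists_eq_add_of_le hmn
    have := choose_lt_of_choose_le (z + s * (p + q)) m' p q hq
    have a0 : (s + 2) * q + m' - s * q = m' + q + q := by
      rw [Nat.sub_eq_iff_eq_add (by nlinarith)]; ring
    have a1 : (s + 2) * q + m' - (s + 1) * q = m' + q := by
      rw [Nat.sub_eq_iff_eq_add (by nlinarith)]; ring
    have a2 : (s + 2) * q + m' - (s + 2) * q = m' := by simp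
    simp only [hf, a0, a1, a2] at hle ⊢
    convert this ?_ using 2
    · ring
    · ring
    · convert hle using 2 <;> ring
  have hdrop : ∃ s, s < i ∧ f (s + 1) ≤ f s := by
    by_contra! hcon
    have hmono : ∀ s, s ≤ i → f 0 + s ≤ f s := by
      intro s
      induction s with
      | zero => simp
      | succ s ih =>
        intro hs
        have := ih (by omega)
        have := hcon s (by omega)
        omega
    have := hmono i le_rfl
    simp only [hf, zero_mul, add_zero, Nat.sub_zero] at this
    omega
  obtain ⟨s, hsi, hs⟩ := hdrop
  have hdec : ∀ k, s + k + 2 ≤ j → f (s + k + 2) < f (s + k + 1) := by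
    intro k
    induction k with
    | zero => exact fun hk => key s hk hs
    | succ k ih => exact fun hk => key (s + k + 1) (by omega) (ih (by omega)).le
  have hlt : ∀ k, i + k + 1 ≤ j → f (i + k + 1) < f i := by
    intro k
    induction k with
    | zero =>
      intro hk
      have := hdec (i - s - 1) (by omega)
      rwa [show s + (i - s - 1) + 2 = i + 0 + 1 by omega,
        show s + (i - s - 1) + 1 = i by omega] at this
    | succ k ih =>
      intro hk
      have := hdec (i - s + k) (by omega)
      rw [show s + (i - s + k) + 2 = i + (k + 1) + 1 by omega,
        show s + (i - s + k) + 1 = i + k + 1 by omega] at this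
      exact this.trans (ih (by omega))
  have := hlt (j - i - 1) (by omega)
  rw [show i + (j - i - 1) + 1 = j by omega] at this
  simp only [hf] at this
  omega

lemma log_sub_log_le {x y : ℝ} (hx : 0 < x) (hy : 0 < y) :
    Real.log x - Real.log y ≤ (x - y) / y := by
  rw [← Real.log_div hx.ne' hy.ne', sub_div, div_self hy.ne']
  exact Real.log_le_sub_one_of_pos (div_pos hx hy)

/-- The logarithmic form of `(z + m + b + a).choose m = (z + m + b).choose (m + b)`, to first
order. -/
lemma log_relation_of_choose_eq {z m a b : ℕ} (hz : 0 < z) (hm : 0 < m)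
    (h : (z + m + b + a).choose m = (z + m + b).choose (m + b)) :
    0 ≤ a * Real.log (z + m + b) + b * Real.log (m + b) - (a + b) * Real.log z ∧
    a * Real.log (z + m + b) + b * Real.log (m + b) - (a + b) * Real.log z ≤
      (b : ℝ) ^ 2 / m + ((a : ℝ) + b) ^ 2 / z := by
  have hz' : (0 : ℝ) < z := by exact_mod_cast hz
  have hm' : (0 : ℝ) < m := by exact_mod_cast hm
  have e := choose_mul_ascFactorial_shift z m a b
  rw [h] at e
  replace e := Nat.eq_of_mul_eq_mul_left (Nat.choose_pos (by omega)) e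
  constructor
  · have h1 := ascFactorial_mul_pow_le (show z ≤ z + m + b by omega) a
    have h2 := Nat.ascFactorial_le_pow_add m b
    have h3 : z ^ b ≤ (z + 1 + a).ascFactorial b :=
      (Nat.pow_le_pow_left (by omega) b).trans (Nat.pow_succ_le_ascFactorial (z + 1 + a) b)
    have hC : 0 < (z + 1).ascFactorial a := Nat.ascFactorial_pos _ _
    have h4 : z ^ (a + b) ≤ (z + m + b) ^ a * (m + b) ^ b := by
      refine Nat.le_of_mul_le_mul_left ?_ hC
      calc (z + 1).ascFactorial a * z ^ (a + b)
          = ((z + 1).ascFactorial a * z ^ b) * z ^ a := by ring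
        _ ≤ ((z + 1).ascFactorial a * (z + 1 + a).ascFactorial b) * z ^ a := by gcongr
        _ = ((z + m + b + 1).ascFactorial a * z ^ a) * (m + 1).ascFactorial b := by
          rw [Nat.ascFactorial_mul_ascFactorial, e]; ring
        _ ≤ ((z + m + b) ^ a * (z + 1).ascFactorial a) * (m + b) ^ b := Nat.mul_le_mul h1 h2
        _ = _ := by ring
    have h5 : (z : ℝ) ^ (a + b) ≤ (z + m + b : ℝ) ^ a * (m + b : ℝ) ^ b := by exact_mod_cast h4
    have h6 := Real.log_le_log (by positivity) h5
    rw [Real.log_mul (by positivity) (by positivity), Real.log_pow, Real.log_pow,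
      Real.log_pow] at h6
    push_cast at h6
    linarith
  · have h1 : (z + m + b) ^ a ≤ (z + m + b + 1).ascFactorial a :=
      (Nat.pow_le_pow_left (by omega) a).trans (Nat.pow_succ_le_ascFactorial _ a)
    have h2 : m ^ b ≤ (m + 1).ascFactorial b :=
      (Nat.pow_le_pow_left (by omega) b).trans (Nat.pow_succ_le_ascFactorial _ b)
    have h3 := Nat.ascFactorial_le_pow_add z (a + b)
    have h4 : (z + m + b) ^ a * m ^ b ≤ (z + (a + b)) ^ (a + b) :=
      (Nat.mul_le_mul h1 h2).trans (e ▸ h3)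
    have h5 : (z + m + b : ℝ) ^ a * (m : ℝ) ^ b ≤ (z + (a + b) : ℝ) ^ (a + b) := by
      exact_mod_cast h4
    have h6 := Real.log_le_log (by positivity) h5
    rw [Real.log_mul (by positivity) (by positivity), Real.log_pow, Real.log_pow,
      Real.log_pow] at h6
    push_cast at h6
    have h7 : Real.log (m + b) - Real.log m ≤ ((m + b : ℝ) - m) / m :=
      log_sub_log_le (by positivity) hm'
    have h8 : Real.log (z + (a + b)) - Real.log z ≤ ((z + (a + b) : ℝ) - z) / z :=
      log_sub_log_le (by positivity) hz'
    have h9 := mul_le_mul_of_nonneg_left h7 (Nat.cast_nonneg b : (0 : ℝ) ≤ b)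
    have h10 := mul_le_mul_of_nonneg_left h8 (by positivity : (0 : ℝ) ≤ a + b)
    have e1 : (b : ℝ) * (((m + b : ℝ) - m) / m) = (b : ℝ) ^ 2 / m := by ring
    have e2 : ((a : ℝ) + b) * (((z + (a + b) : ℝ) - z) / z) = ((a : ℝ) + b) ^ 2 / z := by ring
    rw [e1] at h9
    rw [e2] at h10
    linarith

/-- A solution at distance at most `D` from `(n, m)` forces `m ≥ n / (2 D)`, and gives a linear
relation between `log n`, `log m` and `log (n - m)` with a small error. -/
lemma log_relation_of_close {n m a b : ℕ} {D : ℝ} (ha : 0 < a) (hb : 0 < b) (hbm : b < m)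
    (hmn : 2 * m ≤ n) (h : (n + a).choose (m - b) = n.choose m) (hD : (a : ℝ) + b ≤ D)
    (hn : 12 * D ^ 5 < n) :
    (n : ℝ) ≤ 2 * D * m ∧
    0 ≤ a * Real.log n + b * Real.log m - (a + b) * Real.log (n - m) ∧
    a * Real.log n + b * Real.log m - (a + b) * Real.log (n - m) ≤ 6 * D ^ 3 / n := by
  obtain ⟨m', rfl⟩ : ∃ m', m = m' + b := ⟨m - b, by omega⟩
  obtain ⟨z, rfl⟩ : ∃ z, n = z + m' + b := ⟨n - (m' + b), by omega⟩
  rw [Nat.add_sub_cancel] at h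
  have hz : 0 < z := by omega
  have hm' : 0 < m' := by omega
  obtain ⟨hlo, hhi⟩ := log_relation_of_choose_eq hz hm' h
  have ha1 : (1 : ℝ) ≤ a := by exact_mod_cast ha
  have hb1 : (1 : ℝ) ≤ b := by exact_mod_cast hb
  have hzR : (0 : ℝ) < z := by exact_mod_cast hz
  have hmR : (0 : ℝ) < m' := by exact_mod_cast hm'
  have hD2 : 2 ≤ D := by linarith
  have hzm : (m' : ℝ) + b ≤ z := by
    have : m' + b ≤ z := by omega
    exact_mod_cast this
  push_cast at hn ⊢
  have ez : ((z : ℝ) + m' + b - (m' + b)) = z := by ring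
  rw [ez]
  have hmain : (z : ℝ) + m' + b ≤ 2 * D * (m' + b) := by
    by_cases hc : (z : ℝ) ≤ 3 * (m' + b)
    · nlinarith
    · push Not at hc
      have h1 : (1 : ℝ) ≤ Real.log z - Real.log (m' + b) := by
        rw [← Real.log_div hzR.ne' (by positivity), Real.le_log_iff_exp_le (by positivity)]
        have : (3 : ℝ) ≤ z / (m' + b) := by
          rw [le_div_iff₀ (by positivity)]; exact hc.le
        linarith [Real.exp_one_lt_d9]
      have h2 : Real.log (z + m' + b) - Real.log z ≤ ((z + m' + b : ℝ) - z) / z :=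
        log_sub_log_le (by positivity) hzR
      have h3 := mul_le_mul_of_nonneg_left h2 (by positivity : (0 : ℝ) ≤ a)
      have h4 : (1 : ℝ) ≤ b * (Real.log z - Real.log (m' + b)) := by nlinarith
      have h5 : (1 : ℝ) ≤ a * (((z + m' + b : ℝ) - z) / z) := by nlinarith
      have e1 : (a : ℝ) * (((z + m' + b : ℝ) - z) / z) = a * (m' + b) / z := by ring
      rw [e1, le_div_iff₀ hzR, one_mul] at h5
      have h6 : (a : ℝ) * (m' + b) ≤ D * (m' + b) :=
        mul_le_mul_of_nonneg_right (by linarith) (by positivity)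
      linarith
  refine ⟨hmain, hlo, hhi.trans ?_⟩
  set N : ℝ := z + m' + b with hN
  have hNpos : 0 < N := by positivity
  have hD4 : 4 * D ^ 2 ≤ 12 * D ^ 5 := by
    have : (1 : ℝ) ≤ D ^ 3 := one_le_pow₀ (by linarith)
    nlinarith [sq_nonneg D]
  have hm4 : N ≤ 4 * D * m' := by nlinarith
  have hz2 : N ≤ 2 * z := by linarith
  have t1 : (b : ℝ) ^ 2 / m' ≤ 4 * D ^ 3 / N := by
    rw [div_le_div_iff₀ hmR hNpos]
    have : (b : ℝ) ^ 2 ≤ D ^ 2 := by gcongr; linarith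
    calc (b : ℝ) ^ 2 * N ≤ D ^ 2 * (4 * D * m') := by gcongr
      _ = _ := by ring
  have t2 : ((a : ℝ) + b) ^ 2 / z ≤ 2 * D ^ 3 / N := by
    rw [div_le_div_iff₀ hzR hNpos]
    have : ((a : ℝ) + b) ^ 2 ≤ D ^ 3 := by
      calc ((a : ℝ) + b) ^ 2 ≤ D ^ 2 := by gcongr
        _ ≤ D ^ 3 := pow_le_pow_right₀ (by linarith) (by norm_num)
    calc ((a : ℝ) + b) ^ 2 * N ≤ D ^ 3 * (2 * z) := by gcongr
      _ = _ := by ring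
  calc _ ≤ 4 * D ^ 3 / N + 2 * D ^ 3 / N := add_le_add t1 t2
    _ = _ := by ring

/-- Two solutions close to `(n, m)` lie in the same direction from `(n, m)`. -/
lemma cross_mul_le_of_close {n m a b a' b' : ℕ} {D : ℝ} (ha : 0 < a) (hb : 0 < b)
    (hbm : b < m) (ha' : 0 < a') (hb' : 0 < b') (hbm' : b' < m) (hmn : 2 * m ≤ n)
    (h : (n + a).choose (m - b) = n.choose m) (h' : (n + a').choose (m - b') = n.choose m)
    (hD : (a : ℝ) + b ≤ D) (hD' : (a' : ℝ) + b' ≤ D) (hn : 12 * D ^ 5 < n) :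
    a * b' ≤ a' * b := by
  by_contra! hlt
  obtain ⟨hM, h1, h2⟩ := log_relation_of_close ha hb hbm hmn h hD hn
  obtain ⟨-, h1', -⟩ := log_relation_of_close ha' hb' hbm' hmn h' hD' hn
  have hm : (0 : ℝ) < m := by exact_mod_cast (by omega : 0 < m)
  have hb1 : (0 : ℝ) < b := by exact_mod_cast hb
  have ha1 : (0 : ℝ) < a := by exact_mod_cast ha
  have ha1' : (0 : ℝ) < a' := by exact_mod_cast ha'
  have hb1' : (0 : ℝ) < b' := by exact_mod_cast hb'
  have hmn' : (2 : ℝ) * m ≤ n := by exact_mod_cast hmn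
  have hnR : (0 : ℝ) < n := by linarith
  have hzR : (0 : ℝ) < n - m := by linarith
  have hDpos : 0 < D := by linarith
  have hcross : (1 : ℝ) ≤ a * b' - a' * b := by
    have : (a' : ℝ) * b + 1 ≤ a * b' := by exact_mod_cast hlt
    linarith
  have hL : (m : ℝ) / n ≤ Real.log n - Real.log (n - m) := by
    have := log_sub_log_le hzR hnR
    have e : ((n - m : ℝ) - n) / n = -(m / n) := by ring
    linarith
  have hL0 : 0 ≤ Real.log n - Real.log (n - m) := le_trans (by positivity) hL
  have hLup : Real.log n - Real.log (n - m) ≤ D * (6 * D ^ 3 / n) := by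
    calc Real.log n - Real.log (n - m)
        ≤ (a * b' - a' * b) * (Real.log n - Real.log (n - m)) :=
          le_mul_of_one_le_left hL0 hcross
      _ = b' * (a * Real.log n + b * Real.log m - (a + b) * Real.log (n - m)) -
          b * (a' * Real.log n + b' * Real.log m - (a' + b') * Real.log (n - m)) := by ring
      _ ≤ b' * (a * Real.log n + b * Real.log m - (a + b) * Real.log (n - m)) :=
          sub_le_self _ (mul_nonneg hb1.le h1')
      _ ≤ D * (6 * D ^ 3 / n) := by
          apply mul_le_mul (by linarith) h2 h1 hDpos.le
  have hfin : (m : ℝ) / n ≤ 6 * D ^ 4 / n := by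
    calc (m : ℝ) / n ≤ D * (6 * D ^ 3 / n) := hL.trans hLup
      _ = _ := by ring
  rw [div_le_div_iff_of_pos_right hnR] at hfin
  have : 2 * D * m ≤ 2 * D * (6 * D ^ 4) := by gcongr
  nlinarith

/-- For large `n` compared to `D`, at most one solution lies at distance at most `D` from
`(n, m)`, to the upper left of it. -/
lemma eq_of_close {n m a b a' b' : ℕ} {D : ℝ} (ha : 0 < a) (hb : 0 < b)
    (hbm : b < m) (ha' : 0 < a') (hb' : 0 < b') (hbm' : b' < m) (hmn : 2 * m ≤ n)
    (h : (n + a).choose (m - b) = n.choose m) (h' : (n + a').choose (m - b') = n.choose m)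
    (hD : (a : ℝ) + b ≤ D) (hD' : (a' : ℝ) + b' ≤ D) (hn : 12 * D ^ 5 < n) :
    a = a' ∧ b = b' := by
  have hc : a * b' = a' * b := le_antisymm
    (cross_mul_le_of_close ha hb hbm ha' hb' hbm' hmn h h' hD hD' hn)
    (cross_mul_le_of_close ha' hb' hbm' ha hb hbm hmn h' h hD' hD hn)
  obtain ⟨g, p, q, hg, hpq, rfl, rfl⟩ := Nat.exists_coprime' (m := a) (n := b)
    (Nat.gcd_pos_of_pos_left b ha)
  have hp : 0 < p := Nat.pos_of_mul_pos_right ha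
  have hq : 0 < q := Nat.pos_of_mul_pos_right hb
  have hc' : p * b' = a' * q := by
    apply Nat.eq_of_mul_eq_mul_right hg
    linarith
  obtain ⟨s, rfl⟩ : p ∣ a' := hpq.dvd_of_dvd_mul_right ⟨b', hc'.symm⟩
  obtain rfl : b' = s * q := by
    apply Nat.eq_of_mul_eq_mul_left hp
    linarith
  have hs : 0 < s := Nat.pos_of_mul_pos_left ha'
  rw [mul_comm p g, mul_comm q g] at h
  rw [mul_comm p s] at h'
  rcases lt_trichotomy g s with hlt | rfl | hlt
  · exact (not_three_collinear hq hg hlt hbm'.le (by omega) h h').elim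
  · exact ⟨rfl, mul_comm _ _⟩
  · rw [mul_comm] at hbm
    exact (not_three_collinear hq hs hlt hbm.le (by omega) h' h).elim

lemma eventually_pow_exp_log_log_rpow_lt_log (ε K : ℝ) (hε : 0 < ε) (hK : 0 < K) :
    ∀ᶠ t : ℕ in Filter.atTop,
      12 * (K * Real.exp ((Real.log (Real.log t)) ^ ((1 : ℝ) - ε))) ^ 5 < Real.log t := by
  have hlog : Filter.Tendsto (fun t : ℕ => Real.log t) Filter.atTop Filter.atTop :=
    Real.tendsto_log_atTop.comp tendsto_natCast_atTop_atTop
  have hloglog : Filter.Tendsto (fun t : ℕ => Real.log (Real.log t)) Filter.atTop Filter.atTop :=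
    Real.tendsto_log_atTop.comp hlog
  have hpow : ∀ᶠ L : ℝ in Filter.atTop, L ^ (-ε) < 1 / 10 :=
    (tendsto_rpow_neg_atTop hε).eventually_lt_const (by norm_num)
  filter_upwards [hlog.eventually_gt_atTop 0, hloglog.eventually_gt_atTop 0,
    hloglog.eventually hpow,
    hloglog.eventually_gt_atTop (2 * Real.log (12 * K ^ 5))] with t h0 h1 h2 h3
  set L := Real.log (Real.log t)
  have h4 : L ^ ((1 : ℝ) - ε) ≤ L / 10 := by
    rw [sub_eq_add_neg, Real.rpow_add h1, Real.rpow_one]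
    nlinarith
  calc 12 * (K * Real.exp (L ^ ((1 : ℝ) - ε))) ^ 5
      = Real.exp (Real.log (12 * K ^ 5)) * Real.exp (5 * L ^ ((1 : ℝ) - ε)) := by
        rw [Real.exp_log (by positivity), mul_pow, ← Real.exp_nat_mul]
        push_cast
        ring
    _ = Real.exp (Real.log (12 * K ^ 5) + 5 * L ^ ((1 : ℝ) - ε)) := (Real.exp_add _ _).symm
    _ < Real.exp L := Real.exp_lt_exp.mpr (by linarith)
    _ = Real.log t := Real.exp_log h0

lemma log_choose_le (n m : ℕ) : Real.log (n.choose m) ≤ n := by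
  have h : (n.choose m : ℝ) ≤ 2 ^ n := by exact_mod_cast Nat.choose_le_two_pow n m
  rcases (Nat.zero_le (n.choose m)).eq_or_lt with h0 | h0
  · simp [← h0]
  · have h1 := Real.log_le_log (by exact_mod_cast h0) h
    rw [Real.log_pow] at h1
    have h2 : Real.log 2 ≤ 1 := by linarith [Real.log_two_lt_d9]
    nlinarith [Nat.cast_nonneg (α := ℝ) n]


/-- Kane-type estimate: for every `ε > 0` and `K > 0` there is `t₀` such that for every
integer `t ≥ t₀` and every solution `(n,m)` to `C(n,m) = t` in the left half of Pascal's
triangle, there is at most one other solution `(n',m') ≠ (n,m)` in the left half with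
`m' < m`, `n' > n`, and `|m - m'| + |n - n'| ≤ K · exp((log log t)^(1-ε))`. -/
theorem stmt_6 (ε K : ℝ) (hε : 0 < ε) (hK : 0 < K) :
    ∃ t₀ : ℕ, ∀ t : ℕ, t₀ ≤ t → ∀ n m : ℕ,
      1 ≤ m → 2 * m ≤ n → Nat.choose n m = t →
      {q : ℕ × ℕ | q ≠ (n, m) ∧ 1 ≤ q.2 ∧ 2 * q.2 ≤ q.1 ∧
        Nat.choose q.1 q.2 = t ∧ q.2 < m ∧ n < q.1 ∧
        |(m : ℝ) - (q.2 : ℝ)| + |(n : ℝ) - (q.1 : ℝ)| ≤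
          K * Real.exp ((Real.log (Real.log t)) ^ ((1 : ℝ) - ε))}.encard ≤ 1 := by
  obtain ⟨t₀, ht₀⟩ := Filter.eventually_atTop.mp
    (eventually_pow_exp_log_log_rpow_lt_log ε K hε hK)
  refine ⟨t₀, fun t ht n m _ hmn hnm => ?_⟩
  have hbig := ht₀ t ht
  set D := K * Real.exp ((Real.log (Real.log t)) ^ ((1 : ℝ) - ε))
  have hn : 12 * D ^ 5 < n := hbig.trans_le (hnm ▸ log_choose_le n m)
  have shift : ∀ n' m' : ℕ, 1 ≤ m' → n'.choose m' = t → m' < m → n < n' →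
      |(m : ℝ) - m'| + |(n : ℝ) - n'| ≤ D → ∃ a b : ℕ, 0 < a ∧ 0 < b ∧ b < m ∧
        n' = n + a ∧ m' = m - b ∧ (n + a).choose (m - b) = n.choose m ∧ (a : ℝ) + b ≤ D := by
    intro n' m' hm1 hc hlt hgt hd
    obtain ⟨a, rfl⟩ := Nat.exists_eq_add_of_lt hgt
    obtain ⟨b, rfl⟩ := Nat.exists_eq_add_of_lt hlt
    refine ⟨a + 1, b + 1, by omega, by omega, by omega, by omega, by omega, ?_, ?_⟩
    · rw [hnm, ← hc]
      congr 1
      omega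
    · push_cast at hd ⊢
      rw [abs_of_nonneg (by linarith [Nat.cast_nonneg (α := ℝ) b]),
        abs_of_nonpos (by linarith [Nat.cast_nonneg (α := ℝ) a])] at hd
      linarith
  rw [Set.encard_le_one_iff]
  rintro ⟨n₁, m₁⟩ ⟨n₂, m₂⟩ ⟨-, h1, -, hc1, hlt1, hgt1, hd1⟩ ⟨-, h2, -, hc2, hlt2, hgt2, hd2⟩
  obtain ⟨a, b, ha, hb, hbm, rfl, rfl, hc, hD⟩ := shift n₁ m₁ h1 hc1 hlt1 hgt1 hd1
  obtain ⟨a', b', ha', hb', hbm', rfl, rfl, hc', hD'⟩ := shift n₂ m₂ h2 hc2 hlt2 hgt2 hd2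
  obtain ⟨rfl, rfl⟩ := eq_of_close ha hb hbm ha' hb' hbm' hmn hc hc' hD hD' hn
  rfl
end

section
/- For every ε with 0 < ε < 1 there exists t₀(ε) such that the following holds for every integer t ≥ t₀(ε). Let (n,m), (n',m') be pairs of integers with 1 ≤ m ≤ n/2, 1 ≤ m' ≤ n'/2, C(n,m) = C(n',m') = t, and m' < m (hence n' > n), and suppose that at least one of the statements 'm − m' ≥ exp((log n')^{2/3+ε})' and 'min(m, m', n' − n) ≥ exp((log n')^{2/3+ε})' holds. Then there exists a real P > 1 such that: (i) m, m', n, n' ≤ exp((log P)^{3/2 − ε/10}); (ii) for all integers a, a', b, b' with |a|, |a'|, |b|, |b'| ≤ (log P)^{1/100} and every integer j ≥ 1, either |am + a'm' + bn + b'n'| ≤ P^j/(log P)^{1000} or |am + a'm' + bn + b'n'| ≥ P^j·(log P)^{1000}; (iii) at least one of the statements 'm − m' ≥ P·(log P)^{100}' and 'min(m, m', n' − n) ≥ P·(log P)^{100}' holds. -/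
/-- In the left half of Pascal's triangle, equal binomial coefficients with a smaller lower index
have a larger upper index. -/
theorem le_of_choose_eq_choose_of_lt {n m n' m' : ℕ} (hm' : 1 ≤ m') (hmn : 2 * m ≤ n)
    (hmn' : 2 * m' ≤ n') (h : n.choose m = n'.choose m') (hlt : m' < m) : n ≤ n' := by
  by_contra! hn
  have hmono : ∀ i, m' ≤ i → i ≤ m → n.choose m' ≤ n.choose i := by
    intro i hi
    induction i, hi using Nat.le_induction with
    | base => exact fun _ => le_rfl
    | succ i _ ih =>
      exact fun him => (ih (by omega)).trans (Nat.choose_le_succ_of_lt_half_left (by omega))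
  have hstrict : n'.choose m' < (n' + 1).choose m' := by
    obtain ⟨k, rfl⟩ : ∃ k, m' = k + 1 := ⟨m' - 1, by omega⟩
    have : 0 < n'.choose k := Nat.choose_pos (by omega)
    rw [Nat.choose_succ_succ']
    omega
  have : (n' + 1).choose m' ≤ n.choose m' := Nat.choose_le_choose _ hn
  have := hmono m hlt.le le_rfl
  omega

/-- Logarithmic form of the failure of the dichotomy at the scale `exp u`. -/
theorem log_bounds_of_pow_bounds {u V c : ℝ} {j : ℕ} (hu : 0 < u) (hc : Real.log u ≤ 100 * c)
    (hlo : Real.exp u ^ j / u ^ (1000 : ℕ) < V) (hhi : V < Real.exp u ^ j * u ^ (1000 : ℕ)) :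
    j * u - 100000 * c < Real.log V ∧ Real.log V < j * u + 100000 * c := by
  have hV : 0 < V := lt_of_le_of_lt (by positivity) hlo
  have h1 := Real.log_lt_log (by positivity) hlo
  have h2 := Real.log_lt_log hV hhi
  rw [Real.log_div (by positivity) (by positivity), Real.log_pow, Real.log_exp,
    Real.log_pow, Nat.cast_ofNat] at h1
  rw [Real.log_mul (by positivity) (by positivity), Real.log_pow, Real.log_exp,
    Real.log_pow, Nat.cast_ofNat] at h2
  constructor <;> linarith

/-- Pigeonhole selection of a scale `exp u`, with `u` in a short interval, whose powers avoid all
integer combinations of four given quantities with small coefficients. -/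
theorem exists_scale {x U N : ℝ} {y₁ y₂ y₃ y₄ : ℝ} (hx : 200 ≤ x)
    (hlog : 200000 * Real.log x < x) (hxU : x ^ 66 ≤ U) (hUx : U + x ^ 41 ≤ x ^ 100)
    (hN : N = Real.exp (x ^ 100)) (h₁ : |y₁| ≤ N) (h₂ : |y₂| ≤ N) (h₃ : |y₃| ≤ N)
    (h₄ : |y₄| ≤ N) :
    ∃ u : ℝ, U ≤ u ∧ u ≤ U + x ^ 41 ∧ ∀ a a' b b' : ℤ,
      |(a : ℝ)| ≤ u ^ ((1 : ℝ) / 100) → |(a' : ℝ)| ≤ u ^ ((1 : ℝ) / 100) →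
      |(b : ℝ)| ≤ u ^ ((1 : ℝ) / 100) → |(b' : ℝ)| ≤ u ^ ((1 : ℝ) / 100) →
      ∀ j : ℕ, 1 ≤ j →
        |a * y₁ + a' * y₂ + b * y₃ + b' * y₄| ≤ Real.exp u ^ j / u ^ (1000 : ℕ) ∨
        Real.exp u ^ j * u ^ (1000 : ℕ) ≤ |a * y₁ + a' * y₂ + b * y₃ + b' * y₄| := by
  have hx0 : 0 < x := by linarith
  have hx1 : 1 ≤ x := by linarith
  have hlogx : 0 ≤ Real.log x := Real.log_nonneg hx1
  by_contra! hbad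
  set K := ⌊x ^ 40⌋₊ with hK
  set A := ⌊x⌋₊ with hA
  set J := ⌊2 * x ^ 34⌋₊ with hJ
  have hgrid : ∀ k ≤ K, U ≤ U + k * x ∧ U + k * x ≤ U + x ^ 41 := by
    intro k hk
    have h1 : (k : ℝ) ≤ x ^ 40 :=
      (Nat.cast_le.2 hk).trans (Nat.floor_le (by positivity))
    have h2 : (k : ℝ) * x ≤ x ^ 40 * x := by gcongr
    have h3 : 0 ≤ (k : ℝ) * x := by positivity
    constructor
    · linarith
    · linarith [h2.trans_eq (pow_succ x 40).symm]
  have hupos : ∀ k ≤ K, 1 ≤ U + k * x := fun k hk =>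
    ((one_le_pow₀ hx1).trans hxU).trans (hgrid k hk).1
  have hlogu : ∀ k ≤ K, Real.log (U + k * x) ≤ 100 * Real.log x := by
    intro k hk
    have := Real.log_le_log (by linarith [hupos k hk]) ((hgrid k hk).2.trans hUx)
    rwa [Real.log_pow, Nat.cast_ofNat] at this
  have hroot : ∀ k ≤ K, (U + k * x) ^ ((1 : ℝ) / 100) ≤ x := by
    intro k hk
    calc (U + k * x) ^ ((1 : ℝ) / 100) ≤ (x ^ 100) ^ ((1 : ℝ) / 100) :=
          Real.rpow_le_rpow (by linarith [hupos k hk]) ((hgrid k hk).2.trans hUx) (by norm_num)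
      _ = x := by
          rw [← Real.rpow_natCast x 100, ← Real.rpow_mul hx0.le]
          norm_num
  have hex : ∀ k : ℕ, ∃ p : ℤ × ℤ × ℤ × ℤ × ℕ, k ≤ K →
      (p ∈ Finset.Icc (-(A : ℤ)) A ×ˢ Finset.Icc (-(A : ℤ)) A ×ˢ Finset.Icc (-(A : ℤ)) A ×ˢ
        Finset.Icc (-(A : ℤ)) A ×ˢ Finset.Icc 1 J) ∧
      p.2.2.2.2 * (U + k * x) - 100000 * Real.log x <
        Real.log |p.1 * y₁ + p.2.1 * y₂ + p.2.2.1 * y₃ + p.2.2.2.1 * y₄| ∧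
      Real.log |p.1 * y₁ + p.2.1 * y₂ + p.2.2.1 * y₃ + p.2.2.2.1 * y₄| <
        p.2.2.2.2 * (U + k * x) + 100000 * Real.log x := by
    intro k
    by_cases hk : k ≤ K
    swap
    · exact ⟨0, fun h => absurd h hk⟩
    obtain ⟨a, a', b, b', ha, ha', hb, hb', j, hj, hlo, hhi⟩ :=
      hbad (U + k * x) (hgrid k hk).1 (hgrid k hk).2
    have hmem : ∀ c : ℤ, |(c : ℝ)| ≤ (U + k * x) ^ ((1 : ℝ) / 100) →
        |(c : ℝ)| ≤ x ∧ c ∈ Finset.Icc (-(A : ℤ)) A := by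
      intro c hc
      have h1 := hc.trans (hroot k hk)
      have h2 : c.natAbs ≤ A := Nat.le_floor (by simpa using h1)
      refine ⟨h1, ?_⟩
      rw [Finset.mem_Icc]
      omega
    obtain ⟨hax, hA1⟩ := hmem a ha
    obtain ⟨hax', hA2⟩ := hmem a' ha'
    obtain ⟨hbx, hA3⟩ := hmem b hb
    obtain ⟨hbx', hA4⟩ := hmem b' hb'
    have hu := hupos k hk
    have hlu := hlogu k hk
    have hUk := (hgrid k hk).1
    set u := U + k * x
    have hu0 : 0 < u := by linarith
    set V := |a * y₁ + a' * y₂ + b * y₃ + b' * y₄| with hV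
    have hV0 : 0 < V := lt_of_le_of_lt (div_nonneg (pow_nonneg (Real.exp_pos u).le j)
      (pow_nonneg hu0.le 1000)) hlo
    obtain ⟨hlo', hhi'⟩ := log_bounds_of_pow_bounds hu0 hlu hlo hhi
    clear hlo hhi
    have hterm : ∀ c y : ℝ, |c| ≤ x → |y| ≤ N → |c * y| ≤ x * N := by
      intro c y hc hy
      rw [abs_mul]
      gcongr
    have hVle : V ≤ 4 * x * N := by
      have e1 := hterm _ _ hax h₁
      have e2 := hterm _ _ hax' h₂
      have e3 := hterm _ _ hbx h₃
      have e4 := hterm _ _ hbx' h₄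
      have t1 := abs_add_le (a * y₁ + a' * y₂ + b * y₃) (b' * y₄)
      have t2 := abs_add_le (a * y₁ + a' * y₂) (b * y₃)
      have t3 := abs_add_le (a * y₁) (a' * y₂)
      linarith
    have hVlog : Real.log V ≤ 2 * Real.log x + x ^ 100 := by
      have hN' : 4 * x * N ≤ x ^ 2 * N := by
        have : 0 < N := hN ▸ Real.exp_pos _
        gcongr
        nlinarith
      have := Real.log_le_log hV0 (hVle.trans hN')
      rw [hN, Real.log_mul (by positivity) (by positivity), Real.log_exp, Real.log_pow] at this
      exact_mod_cast this
    have hjJ : j ≤ J := by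
      apply Nat.le_floor
      have hxx : x ≤ x ^ 100 := le_self_pow₀ hx1 (by norm_num)
      have h1 : j * u ≤ 2 * x ^ 100 := by linarith
      have h2 : (j : ℝ) * x ^ 66 ≤ j * u := by
        gcongr
        exact hxU.trans hUk
      have h3 : (j : ℝ) * x ^ 66 ≤ 2 * x ^ 34 * x ^ 66 := by
        rw [mul_assoc, ← pow_add]
        exact h2.trans h1
      exact le_of_mul_le_mul_right h3 (by positivity)
    refine ⟨(a, a', b, b', j), fun _ => ⟨?_, hlo', hhi'⟩⟩
    simp only [Finset.mem_product]
    exact ⟨hA1, hA2, hA3, hA4, Finset.mem_Icc.2 ⟨hj, hjJ⟩⟩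
  choose f hf using hex
  have hcard : (Finset.Icc (-(A : ℤ)) A ×ˢ Finset.Icc (-(A : ℤ)) A ×ˢ
      Finset.Icc (-(A : ℤ)) A ×ˢ Finset.Icc (-(A : ℤ)) A ×ˢ Finset.Icc 1 J).card <
      (Finset.range (K + 1)).card := by
    simp only [Finset.card_product, Int.card_Icc, Nat.card_Icc, Finset.card_range]
    have e : ((A : ℤ) + 1 - -A).toNat = 2 * A + 1 := by omega
    rw [e, Nat.add_sub_cancel, ← Nat.cast_lt (α := ℝ)]
    push_cast
    have hA' : (A : ℝ) ≤ x := Nat.floor_le hx0.le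
    have hJ' : (J : ℝ) ≤ 2 * x ^ 34 := Nat.floor_le (by positivity)
    have hB : 2 * (A : ℝ) + 1 ≤ 3 * x := by linarith
    have hK' : x ^ 40 < (K : ℝ) + 1 := Nat.lt_floor_add_one _
    calc (2 * (A : ℝ) + 1) * ((2 * A + 1) * ((2 * A + 1) * ((2 * A + 1) * J)))
        ≤ 3 * x * (3 * x * (3 * x * (3 * x * (2 * x ^ 34)))) := by gcongr
      _ = 162 * x ^ 38 := by ring
      _ ≤ x ^ 2 * x ^ 38 := by gcongr; nlinarith
      _ = x ^ 40 := by ring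
      _ < K + 1 := hK'
  obtain ⟨k, hk, l, hl, hkl, hfkl⟩ := Finset.exists_ne_map_eq_of_card_lt_of_maps_to hcard
    (fun k hk => (hf k (by simpa [Nat.lt_succ_iff] using hk)).1)
  wlog hlt : k < l generalizing k l
  · exact this l hl k hk hkl.symm hfkl.symm (by omega)
  have hk' : k ≤ K := by simpa [Nat.lt_succ_iff] using hk
  have hl' : l ≤ K := by simpa [Nat.lt_succ_iff] using hl
  obtain ⟨hmem, -, hhi⟩ := hf k hk'
  obtain ⟨-, hlo, -⟩ := hf l hl'
  rw [← hfkl] at hlo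
  have hj : 1 ≤ (f k).2.2.2.2 := by
    simp only [Finset.mem_product, Finset.mem_Icc] at hmem
    exact hmem.2.2.2.2.1
  have hj' : (1 : ℝ) ≤ (f k).2.2.2.2 := by exact_mod_cast hj
  have hkl' : (k : ℝ) + 1 ≤ l := by exact_mod_cast hlt
  have h1 : x ≤ ((l : ℝ) - k) * x := le_mul_of_one_le_left hx0.le (by linarith)
  have h2 : ((l : ℝ) - k) * x ≤ (f k).2.2.2.2 * (((l : ℝ) - k) * x) :=
    le_mul_of_one_le_left (hx0.le.trans h1) hj'
  have h3 := hlo.trans hhi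
  nlinarith

/-- The growth conditions on `L` needed to place the interval of candidate scales. -/
theorem eventually_scale_bounds {ε : ℝ} (hε0 : 0 < ε) :
    ∀ᶠ L : ℝ in Filter.atTop, 1 ≤ L ∧ 200 ≤ L ^ ((1 : ℝ) / 100) ∧
      200000 * Real.log (L ^ ((1 : ℝ) / 100)) < L ^ ((1 : ℝ) / 100) ∧ 3 ≤ L ^ (ε / 2) := by
  have hx : Filter.Tendsto (fun L : ℝ => L ^ ((1 : ℝ) / 100)) Filter.atTop Filter.atTop :=
    tendsto_rpow_atTop (by norm_num)
  have hlog : ∀ᶠ x : ℝ in Filter.atTop, 200000 * Real.log x < x := by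
    filter_upwards [Real.isLittleO_log_id_atTop.bound (show (0 : ℝ) < 1 / 400000 by norm_num),
      Filter.eventually_gt_atTop 0] with x h hx
    rw [id, Real.norm_eq_abs, Real.norm_eq_abs, abs_of_pos hx] at h
    linarith [le_abs_self (Real.log x)]
  filter_upwards [Filter.eventually_ge_atTop 1, hx.eventually_ge_atTop 200, hx.eventually hlog,
    (tendsto_rpow_atTop (half_pos hε0)).eventually_ge_atTop 3] with L h1 h2 h3 h4
  exact ⟨h1, h2, h3, h4⟩


/-- Selection of scale: for `0 < ε < 1` and `t` large, given two solutions
`(n,m)`, `(n',m')` of `C(n,m) = C(n',m') = t` in the left half of Pascal's triangle with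
`m' < m` and satisfying the separation hypothesis, there is a scale `P > 1` satisfying
(i) size bounds, (ii) a dichotomy for small integer combinations, and (iii) separation. -/
theorem stmt_9 (ε : ℝ) (hε0 : 0 < ε) (hε1 : ε < 1) :
    ∃ t₀ : ℕ, ∀ t : ℕ, t₀ ≤ t → ∀ n m n' m' : ℕ,
      1 ≤ m → 2 * m ≤ n → 1 ≤ m' → 2 * m' ≤ n' →
      Nat.choose n m = t → Nat.choose n' m' = t → m' < m →
      (Real.exp ((Real.log n') ^ ((2 : ℝ) / 3 + ε)) ≤ (m : ℝ) - (m' : ℝ) ∨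
        Real.exp ((Real.log n') ^ ((2 : ℝ) / 3 + ε)) ≤
          min (m : ℝ) (min (m' : ℝ) ((n' : ℝ) - (n : ℝ)))) →
      ∃ P : ℝ, 1 < P ∧
        ((m : ℝ) ≤ Real.exp ((Real.log P) ^ ((3 : ℝ) / 2 - ε / 10)) ∧
          (m' : ℝ) ≤ Real.exp ((Real.log P) ^ ((3 : ℝ) / 2 - ε / 10)) ∧
          (n : ℝ) ≤ Real.exp ((Real.log P) ^ ((3 : ℝ) / 2 - ε / 10)) ∧
          (n' : ℝ) ≤ Real.exp ((Real.log P) ^ ((3 : ℝ) / 2 - ε / 10))) ∧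
        (∀ a a' b b' : ℤ,
          |(a : ℝ)| ≤ (Real.log P) ^ ((1 : ℝ) / 100) →
          |(a' : ℝ)| ≤ (Real.log P) ^ ((1 : ℝ) / 100) →
          |(b : ℝ)| ≤ (Real.log P) ^ ((1 : ℝ) / 100) →
          |(b' : ℝ)| ≤ (Real.log P) ^ ((1 : ℝ) / 100) →
          ∀ j : ℕ, 1 ≤ j →
            |(a : ℝ) * m + (a' : ℝ) * m' + (b : ℝ) * n + (b' : ℝ) * n'| ≤
              P ^ j / (Real.log P) ^ (1000 : ℕ) ∨
            P ^ j * (Real.log P) ^ (1000 : ℕ) ≤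
              |(a : ℝ) * m + (a' : ℝ) * m' + (b : ℝ) * n + (b' : ℝ) * n'|) ∧
        (P * (Real.log P) ^ (100 : ℕ) ≤ (m : ℝ) - (m' : ℝ) ∨
          P * (Real.log P) ^ (100 : ℕ) ≤
            min (m : ℝ) (min (m' : ℝ) ((n' : ℝ) - (n : ℝ)))) := by
  have hev := (Real.tendsto_log_atTop.comp tendsto_natCast_atTop_atTop).eventually
    (eventually_scale_bounds hε0)
  obtain ⟨N₀, hN₀⟩ := Filter.eventually_atTop.1 hev
  refine ⟨2 ^ N₀, fun t ht n m n' m' hm hmn hm' hmn' hc hc' hlt hsep => ?_⟩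
  have hn'N : N₀ ≤ n' := (Nat.pow_le_pow_iff_right (by norm_num : 1 < 2)).1
    (ht.trans (hc' ▸ Nat.choose_le_two_pow n' m'))
  have hnn' : n ≤ n' := le_of_choose_eq_choose_of_lt hm' hmn hmn' (hc.trans hc'.symm) hlt
  obtain ⟨hL1, hx, hlog, h3⟩ := hN₀ n' hn'N
  simp only [Function.comp_apply] at hL1 hx hlog h3
  set L := Real.log n' with hL
  have hn'pos : (0 : ℝ) < n' := by exact_mod_cast (show 0 < n' by omega)
  have hL0 : 0 < L := by linarith
  have hexpL : Real.exp L = n' := Real.exp_log hn'pos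
  have hnR : (n : ℝ) ≤ n' := by exact_mod_cast hnn'
  have hmR : (m : ℝ) ≤ n' := by exact_mod_cast (show m ≤ n' by omega)
  have hm'R : (m' : ℝ) ≤ n' := by exact_mod_cast (show m' ≤ n' by omega)
  have hle : L ^ ((2 : ℝ) / 3 + ε) ≤ L := by
    rw [← Real.exp_le_exp, hexpL]
    rcases hsep with h | h
    · linarith [(Nat.cast_nonneg m' : (0 : ℝ) ≤ m')]
    · exact (h.trans (min_le_left _ _)).trans hmR
  set x := L ^ ((1 : ℝ) / 100) with hxdef
  have hxpow : ∀ k : ℕ, x ^ k = L ^ ((k : ℝ) / 100) := by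
    intro k
    rw [hxdef, ← Real.rpow_natCast, ← Real.rpow_mul hL0.le]
    congr 1
    ring
  have hx100 : x ^ 100 = L := by rw [hxpow]; norm_num
  set U := L ^ ((2 : ℝ) / 3 + ε / 2) with hU
  have hxkU : ∀ k : ℕ, k ≤ 66 → x ^ k ≤ U := by
    intro k hk
    rw [hxpow]
    have : (k : ℝ) ≤ 66 := by exact_mod_cast hk
    exact Real.rpow_le_rpow_of_exponent_le hL1 (by linarith)
  have h3U : 3 * U ≤ L ^ ((2 : ℝ) / 3 + ε) := by
    rw [show (2 : ℝ) / 3 + ε = ε / 2 + (2 / 3 + ε / 2) by ring, Real.rpow_add hL0]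
    gcongr
  have hx41 := hxkU 41 (by norm_num)
  have hx1 : x ≤ U := by simpa using hxkU 1 (by norm_num)
  obtain ⟨u, hUu, huU, hdich⟩ := exists_scale (y₁ := m) (y₂ := m') (y₃ := n) (y₄ := n')
    (N := n') hx hlog (hxkU 66 le_rfl) (by rw [hx100]; linarith) (by rw [hx100, hexpL])
    (by simpa using hmR) (by simpa using hm'R) (by simpa using hnR) (by simp)
  have hu0 : 0 < u := by linarith
  have hlogu : Real.log u ≤ 100 * Real.log x := by
    have := Real.log_le_log hu0 (show u ≤ x ^ 100 by rw [hx100]; linarith)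
    rwa [Real.log_pow, Nat.cast_ofNat] at this
  have hlogx : 0 ≤ Real.log x := Real.log_nonneg (by linarith)
  have hP : Real.exp u * u ^ (100 : ℕ) ≤ Real.exp (L ^ ((2 : ℝ) / 3 + ε)) := by
    rw [← Real.exp_log (pow_pos hu0 100), ← Real.exp_add, Real.exp_le_exp, Real.log_pow,
      Nat.cast_ofNat]
    linarith
  have hsize : (n' : ℝ) ≤ Real.exp (u ^ ((3 : ℝ) / 2 - ε / 10)) := by
    rw [← hexpL, Real.exp_le_exp]
    calc L = L ^ (1 : ℝ) := (Real.rpow_one L).symm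
      _ ≤ L ^ (((2 : ℝ) / 3 + ε / 2) * (3 / 2 - ε / 10)) :=
          Real.rpow_le_rpow_of_exponent_le hL1 (by nlinarith)
      _ = U ^ ((3 : ℝ) / 2 - ε / 10) := Real.rpow_mul hL0.le _ _
      _ ≤ u ^ ((3 : ℝ) / 2 - ε / 10) :=
          Real.rpow_le_rpow (by positivity) hUu (by linarith)
  refine ⟨Real.exp u, Real.one_lt_exp_iff.2 hu0, ?_⟩
  rw [Real.log_exp]
  exact ⟨⟨hmR.trans hsize, hm'R.trans hsize, hnR.trans hsize, hsize⟩, hdich,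
    hsep.imp hP.trans hP.trans⟩
end

section
/- Let k ≥ 1 be a natural number, let I ⊆ ℝ be an interval of length |I|, and let f : I → ℝ be a smooth function satisfying 0 < |f^{(k)}(x)/k!| < |I|^{−k(k+1)/2} for all x ∈ I. Then there are at most k integers m ∈ I for which f(m) is also an integer. -/
open Set Polynomial

/-- Iterated Rolle theorem: a `C^k` function on `[a, b]` with `k + 1` zeros there has a zero of its
`k`-th derivative. -/
theorem exists_iteratedDerivWithin_eq_zero {a b : ℝ} (hab : a < b) (k : ℕ) :
    ∀ (g : ℝ → ℝ), ContDiffOn ℝ k g (Icc a b) → ∀ x : Fin (k + 1) → ℝ, StrictMono x →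
      (∀ i, x i ∈ Icc a b) → (∀ i, g (x i) = 0) →
      ∃ ξ ∈ Icc a b, iteratedDerivWithin k g (Icc a b) ξ = 0 := by
  induction k with
  | zero => exact fun g _ x _ hx h0 ↦ ⟨x 0, hx 0, by simpa using h0 0⟩
  | succ k ih =>
    intro g hg x hmono hx h0
    have hy : ∀ i : Fin (k + 1), ∃ y ∈ Ioo (x i.castSucc) (x i.succ), deriv g y = 0 := fun i ↦
      exists_deriv_eq_zero (hmono i.castSucc_lt_succ)
        (hg.continuousOn.mono (Icc_subset_Icc (hx _).1 (hx _).2)) (by rw [h0, h0])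
    choose y hy hy0 using hy
    have hymem (i) : y i ∈ Ioo a b :=
      ⟨(hx _).1.trans_lt (hy i).1, (hy i).2.trans_le (hx _).2⟩
    obtain ⟨ξ, hξ, h⟩ := ih (derivWithin g (Icc a b))
      (hg.derivWithin (uniqueDiffOn_Icc hab) (by norm_cast)) y
      (fun i j hij ↦ (hy i).2.trans_le <|
        (hmono.monotone (Fin.succ_le_castSucc_iff.mpr hij)).trans (hy j).1.le)
      (fun i ↦ Ioo_subset_Icc_self (hymem i))
      (fun i ↦ by rw [derivWithin_of_mem_nhds (Icc_mem_nhds (hymem i).1 (hymem i).2), hy0])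
    exact ⟨ξ, hξ, by rw [iteratedDerivWithin_succ', h]⟩

theorem Polynomial.iteratedDeriv_eval (p : ℝ[X]) (n : ℕ) :
    iteratedDeriv n (fun x ↦ p.eval x) = fun x ↦ (derivative^[n] p).eval x := by
  induction n with
  | zero => simp
  | succ n ih =>
    rw [iteratedDeriv_succ, ih]
    ext x
    rw [Polynomial.deriv, Function.iterate_succ_apply']

theorem Polynomial.iterate_derivative_of_natDegree_le {p : ℝ[X]} {n : ℕ} (h : p.natDegree ≤ n) :
    derivative^[n] p = C ((n.factorial : ℝ) * p.coeff n) := by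
  have hdeg : (derivative^[n] p).natDegree ≤ 0 :=
    (natDegree_iterate_derivative p n).trans (by omega)
  rw [eq_C_of_natDegree_le_zero hdeg, coeff_iterate_derivative]
  simp [Nat.descFactorial_self]

/-- Mean value theorem for divided differences: the top coefficient of a polynomial of degree at
most `k` agreeing with `f` at `k + 1` points is a value of `f⁽ᵏ⁾ / k!`. -/
theorem exists_iteratedDerivWithin_div_factorial_eq_coeff {a b : ℝ} (hab : a < b) {k : ℕ}
    {f : ℝ → ℝ} (hf : ContDiffOn ℝ k f (Icc a b)) {x : Fin (k + 1) → ℝ} (hmono : StrictMono x)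
    (hx : ∀ i, x i ∈ Icc a b) {p : ℝ[X]} (hp : p.natDegree ≤ k)
    (hpf : ∀ i, p.eval (x i) = f (x i)) :
    ∃ ξ ∈ Icc a b, iteratedDerivWithin k f (Icc a b) ξ / (k.factorial : ℝ) = p.coeff k := by
  have hpc : ContDiff ℝ k (fun x ↦ p.eval x) := by
    simpa using p.contDiff_aeval (𝕜 := ℝ) k
  obtain ⟨ξ, hξ, h⟩ := exists_iteratedDerivWithin_eq_zero hab k (f - fun x ↦ p.eval x)
    (hf.sub hpc.contDiffOn) x hmono hx (fun i ↦ by simp [hpf])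
  refine ⟨ξ, hξ, ?_⟩
  rw [iteratedDerivWithin_sub hξ (uniqueDiffOn_Icc hab) (hf ξ hξ) hpc.contDiffWithinAt,
    iteratedDerivWithin_eq_iteratedDeriv (uniqueDiffOn_Icc hab) hpc.contDiffAt hξ,
    p.iteratedDeriv_eval, iterate_derivative_of_natDegree_le hp, sub_eq_zero] at h
  simp only [eval_C] at h
  rw [h, mul_div_cancel_left₀ _ (by positivity)]

/-- The Vandermonde determinant clears the denominators of a polynomial taking integer values at
integer nodes. -/
theorem exists_det_vandermonde_mul_coeff_eq_intCast {n : ℕ} (v z : Fin n → ℤ) {p : ℝ[X]}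
    (hp : p.natDegree < n) (hpz : ∀ i, p.eval (v i : ℝ) = z i) (j : Fin n) :
    ∃ w : ℤ, ((Matrix.vandermonde v).det : ℝ) * p.coeff j = w := by
  set A := Matrix.vandermonde v
  set B := A.map (Int.castRingHom ℝ)
  have hB : B.mulVec (fun i ↦ p.coeff i) = fun i ↦ (z i : ℝ) := by
    ext i
    rw [← hpz, eval_eq_sum_range' hp, Finset.sum_range]
    simp [B, A, Matrix.mulVec, dotProduct, Matrix.vandermonde_apply, mul_comm]
  have hadj := congrArg (fun u ↦ (B.adjugate.mulVec u) j) hB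
  simp only [Matrix.mulVec_mulVec, Matrix.adjugate_mul, Matrix.smul_mulVec, Matrix.one_mulVec,
    Pi.smul_apply, smul_eq_mul] at hadj
  refine ⟨A.adjugate.mulVec z j, ?_⟩
  have hdet : B.det = (A.det : ℝ) := ((Int.castRingHom ℝ).map_det A).symm
  have hmap : B.adjugate = A.adjugate.map (Int.castRingHom ℝ) :=
    ((Int.castRingHom ℝ).map_adjugate A).symm
  rw [← hdet, hadj, hmap]
  simp [Matrix.mulVec, dotProduct]

theorem abs_det_vandermonde_le {R : Type*} [CommRing R] [LinearOrder R] [IsStrictOrderedRing R]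
    {n : ℕ} {v : Fin n → R} {L : R} (h : ∀ i j, |v j - v i| ≤ L) :
    |(Matrix.vandermonde v).det| ≤ L ^ (n * (n - 1) / 2) := by
  have hcard : ∑ i : Fin n, (Finset.Ioi i).card = n * (n - 1) / 2 := by
    simp only [Fin.card_Ioi]
    rw [Fin.sum_univ_eq_sum_range (fun i ↦ n - 1 - i), Finset.sum_range_reflect (fun i ↦ i),
      Finset.sum_range_id]
  rw [Matrix.det_vandermonde, Finset.abs_prod, ← hcard, ← Finset.prod_pow_eq_pow_sum]
  refine Finset.prod_le_prod (fun _ _ ↦ abs_nonneg _) fun i _ ↦ ?_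
  rw [Finset.abs_prod, ← Finset.prod_const]
  exact Finset.prod_le_prod (fun _ _ ↦ abs_nonneg _) fun j _ ↦ h i j


/-- Small non-zero derivative implies few integer values: if `k ≥ 1`, `I = [a,b]` is an
interval, and `f : I → ℝ` is smooth with `0 < |f⁽ᵏ⁾(x)/k!| < |I|^{-k(k+1)/2}` on `I`,
then at most `k` integers `m ∈ I` have `f(m)` an integer. -/
theorem stmt_12 (k : ℕ) (hk : 1 ≤ k) (a b : ℝ) (f : ℝ → ℝ)
    (hf : ContDiffOn ℝ (⊤ : ℕ∞) f (Set.Icc a b))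
    (hderiv : ∀ x ∈ Set.Icc a b,
      0 < |iteratedDerivWithin k f (Set.Icc a b) x / (Nat.factorial k : ℝ)| ∧
      |iteratedDerivWithin k f (Set.Icc a b) x / (Nat.factorial k : ℝ)| <
        (b - a) ^ (-((k : ℝ) * ((k : ℝ) + 1) / 2))) :
    {m : ℤ | (m : ℝ) ∈ Set.Icc a b ∧ ∃ z : ℤ, f (m : ℝ) = (z : ℝ)}.encard ≤ (k : ℕ∞) := by
  by_contra! hcard
  obtain ⟨t, htS, htcard⟩ := exists_subset_encard_eq (Order.add_one_le_of_lt hcard)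
  have htfin : t.Finite := finite_of_encard_eq_coe (k := k + 1) (by simpa using htcard)
  have hcard' : htfin.toFinset.card = k + 1 := by
    rw [htfin.encard_eq_coe_toFinset_card] at htcard
    exact_mod_cast htcard
  set v := htfin.toFinset.orderEmbOfFin hcard'
  have hv (i) : (v i : ℝ) ∈ Icc a b ∧ ∃ z : ℤ, f (v i) = z :=
    htS (htfin.mem_toFinset.mp (Finset.orderEmbOfFin_mem _ hcard' i))
  choose hvI z hz using hv
  have hmono : StrictMono (fun i ↦ (v i : ℝ)) := Int.cast_strictMono.comp v.strictMono
  have hab : a < b := (hvI 0).1.trans_lt <|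
    (hmono (show (0 : Fin (k + 1)) < Fin.last k by simp [Fin.lt_def]; omega)).trans_le
      (hvI _).2
  have hinj : InjOn (fun i ↦ (v i : ℝ)) (Finset.univ : Finset (Fin (k + 1))) :=
    hmono.injective.injOn
  set p := Lagrange.interpolate Finset.univ (fun i ↦ (v i : ℝ)) (fun i ↦ f (v i))
  have hpf (i) : p.eval (v i : ℝ) = f (v i) :=
    Lagrange.eval_interpolate_at_node _ hinj (Finset.mem_univ i)
  have hdeg : p.natDegree < k + 1 := by
    have := Lagrange.degree_interpolate_le (fun i ↦ f (v i)) hinj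
    rw [Finset.card_univ, Fintype.card_fin, Nat.add_sub_cancel] at this
    exact Nat.lt_succ_of_le (natDegree_le_of_degree_le this)
  obtain ⟨ξ, hξ, hcoeff⟩ := exists_iteratedDerivWithin_div_factorial_eq_coeff hab
    (hf.of_le (by exact_mod_cast le_top)) hmono hvI (Nat.lt_succ_iff.mp hdeg) hpf
  obtain ⟨hpos, hlt⟩ := hderiv ξ hξ
  rw [hcoeff] at hpos hlt
  obtain ⟨w, hw⟩ := exists_det_vandermonde_mul_coeff_eq_intCast v z hdeg
    (fun i ↦ (hpf i).trans (hz i)) (Fin.last k)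
  rw [Fin.val_last] at hw
  have hdet0 : (Matrix.vandermonde v).det ≠ 0 := Matrix.det_vandermonde_ne_zero_iff.mpr v.injective
  have hw0 : w ≠ 0 := by
    rintro rfl
    simp [hdet0, abs_pos.mp hpos] at hw
  have hdetle : |((Matrix.vandermonde v).det : ℝ)| ≤ (b - a) ^ ((k : ℝ) * (k + 1) / 2) := by
    have hcast : ((Matrix.vandermonde v).det : ℝ) = (Matrix.vandermonde fun i ↦ (v i : ℝ)).det := by
      simp [Matrix.det_vandermonde]
    have hexp : (k : ℝ) * (k + 1) / 2 = (((k + 1) * (k + 1 - 1) / 2 : ℕ) : ℝ) := by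
      rw [Nat.cast_div (even_iff_two_dvd.mp (Nat.even_mul_pred_self _)) two_ne_zero]
      push_cast [Nat.add_sub_cancel]
      ring
    rw [hcast, hexp, Real.rpow_natCast]
    refine abs_det_vandermonde_le fun i j ↦ abs_le.mpr ⟨?_, ?_⟩ <;>
      linarith [(hvI i).1, (hvI i).2, (hvI j).1, (hvI j).2]
  have hw1 : |(w : ℝ)| < 1 := by
    rw [← hw, abs_mul]
    calc _ ≤ (b - a) ^ ((k : ℝ) * (k + 1) / 2) * |p.coeff k| := by gcongr
      _ < (b - a) ^ ((k : ℝ) * (k + 1) / 2) * (b - a) ^ (-((k : ℝ) * (k + 1) / 2)) := by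
        have := Real.rpow_pos_of_pos (sub_pos.mpr hab) ((k : ℝ) * (k + 1) / 2)
        gcongr
      _ = 1 := by rw [← Real.rpow_add (sub_pos.mpr hab), add_neg_cancel, Real.rpow_zero]
  exact hw0 (Int.abs_lt_one_iff.mp (by exact_mod_cast hw1))
end

section
/- For every ε with 0 < ε < 1 there exists t₀(ε) such that the following holds for every integer t ≥ t₀(ε): if (n,m) is a pair of integers with n^{1/2+ε} ≤ m ≤ n/2 and C(n,m) = t, then there is at most one pair of integers (n',m') ≠ (n,m) with 1 ≤ m' < n', C(n',m') = t, and m − m^{ε/10} ≤ m' ≤ m. -/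
open Finset in
theorem log_factorial_add (k a : ℕ) :
    Real.log ((k + a).factorial : ℝ) =
      Real.log (k.factorial : ℝ) + ∑ i ∈ range a, Real.log ((k : ℝ) + i + 1) := by
  induction a with
  | zero => simp
  | succ a ih =>
    rw [sum_range_succ, ← add_assoc k a 1, Nat.factorial_succ, Nat.cast_mul, Real.log_mul
      (by positivity) (by positivity), ih]
    push_cast
    ring

theorem log_add_choose (i j : ℕ) :
    Real.log ((i + j).choose j : ℝ) = Real.log ((i + j).factorial : ℝ) -
      Real.log (i.factorial : ℝ) - Real.log (j.factorial : ℝ) := by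
  have h := Nat.add_choose_mul_factorial_mul_factorial i j
  have hc : (0 : ℝ) < ((i + j).choose j : ℝ) := by
    exact_mod_cast Nat.choose_pos (Nat.le_add_left j i)
  rw [← h]
  push_cast
  rw [Real.log_mul (by positivity) (by positivity), Real.log_mul (by positivity) (by positivity)]
  ring

open Finset in
/-- Moving from `(N + h + μ, μ + h)` to `(N + a + h + μ, μ)` in Pascal's triangle. -/
theorem log_choose_sub_log_choose (N μ a h : ℕ) :
    Real.log ((N + a + h + μ).choose μ : ℝ) - Real.log ((N + (μ + h)).choose (μ + h) : ℝ) =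
      ∑ i ∈ range a, Real.log (((N : ℝ) + h + μ + i + 1) / ((N : ℝ) + h + i + 1)) -
      ∑ j ∈ range h, Real.log (((N : ℝ) + j + 1) / ((μ : ℝ) + j + 1)) := by
  have e1 : ∑ i ∈ range a, Real.log (((N : ℝ) + h + μ + i + 1) / ((N : ℝ) + h + i + 1)) =
      ∑ i ∈ range a, Real.log ((N : ℝ) + h + μ + i + 1) -
      ∑ i ∈ range a, Real.log ((N : ℝ) + h + i + 1) := by
    rw [← sum_sub_distrib]
    exact sum_congr rfl fun i _ => Real.log_div (by positivity) (by positivity)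
  have e2 : ∑ j ∈ range h, Real.log (((N : ℝ) + j + 1) / ((μ : ℝ) + j + 1)) =
      ∑ j ∈ range h, Real.log ((N : ℝ) + j + 1) - ∑ j ∈ range h, Real.log ((μ : ℝ) + j + 1) := by
    rw [← sum_sub_distrib]
    exact sum_congr rfl fun i _ => Real.log_div (by positivity) (by positivity)
  have f1 := log_factorial_add (N + h + μ) a
  have f2 := log_factorial_add (N + h) a
  have f3 := log_factorial_add N h
  have f4 := log_factorial_add μ h
  push_cast at f1 f2
  rw [log_add_choose, log_add_choose, e1, e2, show N + a + h + μ = N + h + μ + a by ring,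
    show N + a + h = N + h + a by ring, show N + (μ + h) = N + h + μ by ring]
  linarith

open Finset in
theorem log_choose_strict_concave (N μ α η : ℕ) (hη : 0 < η) :
    Real.log ((N + 2 * (α + η) + μ).choose μ : ℝ) -
        Real.log ((N + (α + η) + (μ + η)).choose (μ + η) : ℝ) <
      Real.log ((N + (α + η) + (μ + η)).choose (μ + η) : ℝ) -
        Real.log ((N + (μ + 2 * η)).choose (μ + 2 * η) : ℝ) := by
  have h1 := log_choose_sub_log_choose (N + α + η) μ α η
  have h2 := log_choose_sub_log_choose N (μ + η) α η
  rw [show N + α + η + α + η + μ = N + 2 * (α + η) + μ by ring,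
    show N + α + η + (μ + η) = N + (α + η) + (μ + η) by ring] at h1
  rw [show N + α + η + (μ + η) = N + (α + η) + (μ + η) by ring,
    show μ + η + η = μ + 2 * η by ring] at h2
  rw [h1, h2]
  push_cast
  rw [sub_eq_add_neg, sub_eq_add_neg]
  refine add_lt_add_of_le_of_lt ?_ (neg_lt_neg ?_)
  · refine sum_le_sum fun i _ => Real.log_le_log (by positivity) ?_
    rw [div_le_div_iff₀ (by positivity) (by positivity)]
    have : (0 : ℝ) ≤ α * μ := by positivity
    have : (0 : ℝ) ≤ η * μ := by positivity
    have : (0 : ℝ) ≤ η * N := by positivity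
    have : (0 : ℝ) ≤ η * i := by positivity
    have : (0 : ℝ) ≤ η * α := by positivity
    have : (0 : ℝ) ≤ η * η := by positivity
    have : (0 : ℝ) ≤ η := by positivity
    nlinarith
  · refine sum_lt_sum_of_nonempty (nonempty_range_iff.2 hη.ne') fun j _ =>
      Real.log_lt_log (by positivity) ?_
    have hη' : (0 : ℝ) < η := by exact_mod_cast hη
    rw [div_lt_div_iff₀ (by positivity) (by positivity)]
    have : (0 : ℝ) ≤ N := by positivity
    have : (0 : ℝ) ≤ α := by positivity
    apply mul_lt_mul'' <;> first | positivity | linarith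

theorem not_three_equal_of_strict_concave (f : ℕ → ℝ) {p q : ℕ} (hp : 0 < p) (hpq : p < q)
    (hf : ∀ s, s + 2 ≤ q → f (s + 2) - f (s + 1) < f (s + 1) - f s)
    (h0p : f 0 = f p) (hpq' : f p = f q) : False := by
  obtain ⟨s, hsp, hs⟩ : ∃ s, s < p ∧ f (s + 1) ≤ f s := by
    by_contra! hcon
    have : ∀ k, k + 1 ≤ p → f 0 < f (k + 1) := by
      intro k
      induction k with
      | zero => exact fun hk => hcon 0 hk
      | succ k ih => exact fun hk => (ih (by omega)).trans (hcon (k + 1) hk)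
    have := this (p - 1) (by omega)
    rw [Nat.sub_add_cancel hp] at this
    exact this.ne h0p
  have hdec : ∀ k, s ≤ k → k + 1 ≤ q → f (k + 1) ≤ f k := by
    intro k hk
    induction k, hk using Nat.le_induction with
    | base => exact fun _ => hs
    | succ k _ ih => exact fun hk => by linarith [ih (by omega), hf k hk]
  have hlt : ∀ k, p ≤ k → k + 1 ≤ q → f (k + 1) < f p := by
    intro k hk
    induction k, hk using Nat.le_induction with
    | base =>
      intro hk
      obtain ⟨r, rfl⟩ : ∃ r, p = r + 1 := ⟨p - 1, by omega⟩
      linarith [hdec r (by omega) (by omega), hf r hk]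
    | succ k hk' ih =>
      exact fun hk => (hdec (k + 1) (by omega) hk).trans_lt (ih (by omega))
  have := hlt (q - 1) (by omega) (by omega)
  rw [Nat.sub_add_cancel (by omega)] at this
  exact this.ne hpq'.symm

/-- Three points of Pascal's triangle with the same value are not collinear. -/
theorem not_collinear_of_choose_eq {n m a h a' h' : ℕ} (hmn : m ≤ n) (hh : 0 < h) (hhh : h < h')
    (hm : h' ≤ m) (h1 : (n + a).choose (m - h) = n.choose m)
    (h2 : (n + a').choose (m - h') = n.choose m) : a * h' ≠ a' * h := by
  intro hcol
  obtain ⟨η, p, q, hη, hcop, rfl, rfl⟩ : ∃ η p q : ℕ, 0 < η ∧ Nat.Coprime p q ∧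
      h = p * η ∧ h' = q * η := by
    obtain ⟨p, q, hc, h3, h4⟩ := Nat.exists_coprime h h'
    exact ⟨h.gcd h', p, q, Nat.gcd_pos_of_pos_left _ hh, hc, h3, h4⟩
  have hp : 0 < p := Nat.pos_of_mul_pos_right hh
  have hpq : p < q := Nat.lt_of_mul_lt_mul_right hhh
  have hcol' : a * q = a' * p := Nat.eq_of_mul_eq_mul_right hη (by linarith)
  obtain ⟨α, rfl⟩ : p ∣ a := hcop.dvd_of_dvd_mul_right ⟨a', by linarith⟩
  obtain rfl : a' = q * α := Nat.eq_of_mul_eq_mul_right hp (by linarith)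
  refine not_three_equal_of_strict_concave
    (fun s => Real.log ((n + s * α).choose (m - s * η) : ℝ)) hp hpq ?_ ?_ ?_
  · intro s hs
    have hle : (s + 2) * η ≤ m := (Nat.mul_le_mul_right η hs).trans hm
    obtain ⟨μ, rfl⟩ := Nat.exists_eq_add_of_le hle
    obtain ⟨N, rfl⟩ := Nat.exists_eq_add_of_le hmn
    have key := log_choose_strict_concave (N + s * (α + η)) μ α η hη
    have s0 : (s + 2) * η + μ - s * η = μ + 2 * η := by
      rw [Nat.sub_eq_iff_eq_add (by nlinarith)]; ring
    have s1 : (s + 2) * η + μ - (s + 1) * η = μ + η := by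
      rw [Nat.sub_eq_iff_eq_add (by nlinarith)]; ring
    have s2 : (s + 2) * η + μ - (s + 2) * η = μ := by simp
    have t0 : (s + 2) * η + μ + N + s * α = N + s * (α + η) + (μ + 2 * η) := by ring
    have t1 : (s + 2) * η + μ + N + (s + 1) * α = N + s * (α + η) + (α + η) + (μ + η) := by ring
    have t2 : (s + 2) * η + μ + N + (s + 2) * α = N + s * (α + η) + 2 * (α + η) + μ := by ring
    simp only [s0, s1, s2, t0, t1, t2]
    exact key
  · simp [h1]
  · simp only [h1, h2]

open Finset in
/-- A crude bound for the increase in the upper index. -/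
theorem mul_le_of_log_choose_eq {N μ a h : ℕ} (hh : 2 * h ≤ μ + h) (hμ : 0 < μ)
    (hlog : 4 * (h : ℝ) * Real.log ((N : ℝ) + h + μ) < (μ : ℝ) + h)
    (heq : ∑ i ∈ range a, Real.log (((N : ℝ) + h + μ + i + 1) / ((N : ℝ) + h + i + 1)) =
      ∑ j ∈ range h, Real.log (((N : ℝ) + j + 1) / ((μ : ℝ) + j + 1))) :
    (a : ℝ) * ((μ : ℝ) + h) ≤ 4 * h * ((N : ℝ) + h + μ) * Real.log ((N : ℝ) + h + μ) := by
  set n : ℝ := (N : ℝ) + h + μ with hn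
  have hμ' : (0 : ℝ) < μ := by exact_mod_cast hμ
  have hn0 : 0 < n := by positivity
  have hh' : 2 * (h : ℝ) ≤ μ + h := by exact_mod_cast hh
  have upper : ∑ j ∈ range h, Real.log (((N : ℝ) + j + 1) / ((μ : ℝ) + j + 1)) ≤
      h * Real.log n := by
    calc _ ≤ ∑ j ∈ range h, Real.log n := by
          refine sum_le_sum fun j hj => Real.log_le_log (by positivity) ?_
          have : (j : ℝ) + 1 ≤ h := by exact_mod_cast mem_range.1 hj
          have : (0 : ℝ) ≤ j := by positivity
          refine (div_le_self (by positivity) (by linarith)).trans (by linarith)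
      _ = _ := by simp
  set b := min a (N + h + μ) with hb
  have lower : (b : ℝ) * (((μ : ℝ) + h) / (4 * n)) ≤
      ∑ i ∈ range a, Real.log ((n + i + 1) / ((N : ℝ) + h + i + 1)) := by
    calc (b : ℝ) * (((μ : ℝ) + h) / (4 * n)) = ∑ i ∈ range b, ((μ : ℝ) + h) / (4 * n) := by simp
      _ ≤ ∑ i ∈ range b, Real.log ((n + i + 1) / ((N : ℝ) + h + i + 1)) := by
          refine sum_le_sum fun i hi => ?_
          refine le_trans ?_ (Real.one_sub_inv_le_log_of_pos (by positivity))
          have hi' : (i : ℝ) + 1 ≤ n := by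
            rw [hn]; exact_mod_cast (mem_range.1 hi).trans_le (min_le_right _ _)
          have : 1 - ((n + i + 1) / ((N : ℝ) + h + i + 1))⁻¹ = μ / (n + i + 1) := by
            rw [inv_div, eq_div_iff (by positivity), sub_mul, div_mul_cancel₀ _ (by positivity)]
            rw [hn]; ring
          rw [this, div_le_div_iff₀ (by positivity) (by positivity)]
          nlinarith
      _ ≤ _ := by
          refine sum_le_sum_of_subset_of_nonneg
            (range_subset_range.2 (min_le_left _ _)) fun i _ _ => Real.log_nonneg ?_
          rw [one_le_div (by positivity)]
          linarith
  have hbm : (b : ℝ) * ((μ : ℝ) + h) ≤ 4 * h * n * Real.log n := by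
    have := lower.trans (heq.le.trans upper)
    rw [← mul_div_assoc, div_le_iff₀ (by positivity)] at this
    linarith
  have hbn : (b : ℝ) < n := by
    have : (b : ℝ) * ((μ : ℝ) + h) < n * ((μ : ℝ) + h) := by nlinarith
    exact lt_of_mul_lt_mul_right this (by positivity)
  have hba : b = a := by
    have : b < N + h + μ := by rw [hn] at hbn; exact_mod_cast hbn
    omega
  rwa [hba] at hbm

open Finset in
/-- The linearisation of `log C(n + a, m - h) = log C(n, m)` has a small nonnegative error. -/
theorem linear_form_bounds {N μ a h : ℕ} (hh : 2 * h ≤ μ + h) (hμ : 0 < μ) (hN : μ + h ≤ N)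
    (hlog1 : 1 ≤ Real.log ((N : ℝ) + h + μ))
    (hlog : 4 * (h : ℝ) * Real.log ((N : ℝ) + h + μ) < (μ : ℝ) + h)
    (heq : ∑ i ∈ range a, Real.log (((N : ℝ) + h + μ + i + 1) / ((N : ℝ) + h + i + 1)) =
      ∑ j ∈ range h, Real.log (((N : ℝ) + j + 1) / ((μ : ℝ) + j + 1))) :
    0 ≤ a * Real.log (((N : ℝ) + h + μ) / N) - h * Real.log ((N : ℝ) / ((μ : ℝ) + h)) ∧
    a * Real.log (((N : ℝ) + h + μ) / N) - h * Real.log ((N : ℝ) / ((μ : ℝ) + h)) ≤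
      43 * (h : ℝ) ^ 2 * Real.log ((N : ℝ) + h + μ) ^ 2 / ((μ : ℝ) + h) := by
  have ha := mul_le_of_log_choose_eq hh hμ hlog heq
  set ℓ := Real.log ((N : ℝ) + h + μ)
  set n : ℝ := (N : ℝ) + h + μ with hn
  set m : ℝ := (μ : ℝ) + h with hm
  have hμ' : (0 : ℝ) < μ := by exact_mod_cast hμ
  have hm0 : 0 < m := by positivity
  have hn0 : 0 < n := by positivity
  have hh' : 2 * (h : ℝ) ≤ m := by rw [hm]; exact_mod_cast hh
  have hNm : m ≤ N := by rw [hm]; exact_mod_cast hN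
  have hnN : n = N + m := by rw [hn, hm]; ring
  have hN0 : (0 : ℝ) < N := by linarith
  have ident : a * Real.log (n / N) - h * Real.log ((N : ℝ) / m) =
      ∑ i ∈ range a, (Real.log (n / N) - Real.log ((n + i + 1) / ((N : ℝ) + h + i + 1))) +
      ∑ j ∈ range h, (Real.log (((N : ℝ) + j + 1) / ((μ : ℝ) + j + 1)) - Real.log (N / m)) := by
    rw [sum_sub_distrib, sum_sub_distrib, heq]
    simp
  have term1 : ∀ i ∈ range a,
      0 ≤ Real.log (n / N) - Real.log ((n + i + 1) / ((N : ℝ) + h + i + 1)) ∧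
      Real.log (n / N) - Real.log ((n + i + 1) / ((N : ℝ) + h + i + 1)) ≤
        2 * h / n + 2 * m * a / n ^ 2 := by
    intro i hi
    have hi' : (i : ℝ) + 1 ≤ a := by exact_mod_cast mem_range.1 hi
    have hi0 : (0 : ℝ) ≤ i := by positivity
    have hh0 : (0 : ℝ) ≤ h := by positivity
    rw [← Real.log_div (by positivity) (by positivity)]
    have e : n / N / ((n + i + 1) / ((N : ℝ) + h + i + 1)) =
        1 + (n * h + m * (i + 1)) / (N * (n + i + 1)) := by
      rw [hnN]; field_simp; ring
    have hq : 0 ≤ (n * h + m * (i + 1)) / (N * (n + i + 1)) := by positivity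
    rw [e]
    refine ⟨Real.log_nonneg (by linarith), ?_⟩
    have := Real.log_le_sub_one_of_pos (show 0 < 1 + (n * h + m * (i + 1)) / (N * (n + i + 1)) by
      positivity)
    calc _ ≤ (n * h + m * (i + 1)) / (N * (n + i + 1)) := by linarith
      _ ≤ (n * h + m * a) / (n / 2 * n) := by
          gcongr <;> linarith
      _ = _ := by field_simp
  have term2 : ∀ j ∈ range h,
      0 ≤ Real.log (((N : ℝ) + j + 1) / ((μ : ℝ) + j + 1)) - Real.log (N / m) ∧
      Real.log (((N : ℝ) + j + 1) / ((μ : ℝ) + j + 1)) - Real.log (N / m) ≤ 3 * h / m := by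
    intro j hj
    have hj' : (j : ℝ) + 1 ≤ h := by exact_mod_cast mem_range.1 hj
    have hj0 : (0 : ℝ) ≤ j := by positivity
    rw [← Real.log_div (by positivity) (by positivity)]
    have e : ((N : ℝ) + j + 1) / ((μ : ℝ) + j + 1) / (N / m) =
        (1 + (j + 1) / N) * (1 + (h - (j + 1)) / (μ + j + 1)) := by
      rw [hm]; field_simp; ring
    have q1 : 0 ≤ ((j : ℝ) + 1) / N := by positivity
    have q2 : 0 ≤ ((h : ℝ) - (j + 1)) / (μ + j + 1) := div_nonneg (by linarith) (by positivity)
    rw [e, Real.log_mul (by positivity) (by positivity)]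
    refine ⟨add_nonneg (Real.log_nonneg (by linarith)) (Real.log_nonneg (by linarith)), ?_⟩
    have l1 := Real.log_le_sub_one_of_pos (show 0 < 1 + ((j : ℝ) + 1) / N by positivity)
    have l2 := Real.log_le_sub_one_of_pos
      (show 0 < 1 + ((h : ℝ) - (j + 1)) / (μ + j + 1) by positivity)
    have b1 : ((j : ℝ) + 1) / N ≤ h / m := by gcongr
    have b2 : ((h : ℝ) - (j + 1)) / (μ + j + 1) ≤ h / (m / 2) := by
      gcongr <;> linarith
    have b3 : (3 : ℝ) * h / m = h / m + h / (m / 2) := by field_simp; ring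
    linarith
  rw [ident]
  refine ⟨add_nonneg (sum_nonneg fun i hi => (term1 i hi).1)
    (sum_nonneg fun j hj => (term2 j hj).1), ?_⟩
  have S1 := sum_le_card_nsmul _ _ _ fun i hi => (term1 i hi).2
  have S2 := sum_le_card_nsmul _ _ _ fun j hj => (term2 j hj).2
  rw [card_range, nsmul_eq_mul] at S1 S2
  have hA : (a : ℝ) / n ≤ 4 * h * ℓ / m := by
    rw [div_le_div_iff₀ hn0 hm0]; linarith
  have r1 : (a : ℝ) * (2 * h / n + 2 * m * a / n ^ 2) =
      2 * h * (a / n) + 2 * m * (a / n) ^ 2 := by field_simp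
  have r2 : 2 * h * (a / n) + 2 * m * (a / n) ^ 2 ≤
      2 * h * (4 * h * ℓ / m) + 2 * m * (4 * h * ℓ / m) ^ 2 := by gcongr
  have r3 : 2 * h * (4 * h * ℓ / m) + 2 * m * (4 * h * ℓ / m) ^ 2 + h * (3 * h / m) =
      (h : ℝ) ^ 2 * (8 * ℓ + 32 * ℓ ^ 2 + 3) / m := by field_simp; ring
  have r4 : (h : ℝ) ^ 2 * (8 * ℓ + 32 * ℓ ^ 2 + 3) / m ≤ 43 * (h : ℝ) ^ 2 * ℓ ^ 2 / m := by
    have : 8 * ℓ + 32 * ℓ ^ 2 + 3 ≤ 43 * ℓ ^ 2 := by nlinarith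
    have := mul_le_mul_of_nonneg_left this (sq_nonneg (h : ℝ))
    exact (div_le_div_iff_of_pos_right hm0).2 (by linarith)
  linarith

theorem linear_form_bounds_of_choose_eq {n m a h : ℕ} (hh : 2 * h ≤ m) (hm : 0 < m)
    (hmn : 2 * m ≤ n) (hlog1 : 1 ≤ Real.log (n : ℝ))
    (hlog : 4 * (h : ℝ) * Real.log (n : ℝ) < m)
    (heq : (n + a).choose (m - h) = n.choose m) :
    0 ≤ a * Real.log ((n : ℝ) / (n - m)) - h * Real.log (((n : ℝ) - m) / m) ∧
    a * Real.log ((n : ℝ) / (n - m)) - h * Real.log (((n : ℝ) - m) / m) ≤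
      43 * (h : ℝ) ^ 2 * Real.log (n : ℝ) ^ 2 / m := by
  obtain ⟨μ, rfl⟩ : ∃ μ, m = μ + h := ⟨m - h, by omega⟩
  obtain ⟨N, rfl⟩ : ∃ N, n = N + h + μ := ⟨n - (μ + h), by omega⟩
  have hid := log_choose_sub_log_choose N μ a h
  rw [Nat.add_sub_cancel] at heq
  rw [show N + (μ + h) = N + h + μ by ring, ← heq,
    show N + a + h + μ = N + h + μ + a by ring, sub_self] at hid
  have := linear_form_bounds (N := N) (a := a) hh (by omega) (by omega)
    (by exact_mod_cast hlog1) (by exact_mod_cast hlog) (by linarith)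
  push_cast
  rwa [show (N : ℝ) + h + μ - (μ + h) = N by ring]

theorem mul_eq_mul_of_choose_eq {n m a h a' h' : ℕ} {H : ℝ} (hH : (h' : ℝ) ≤ H) (hhh : h ≤ h')
    (hHm : 2 * H ≤ m) (hm : 0 < m) (hmn : 2 * m ≤ n) (hlog1 : 1 ≤ Real.log (n : ℝ))
    (hlog : 4 * H * Real.log (n : ℝ) < m)
    (hbig : 43 * H ^ 3 * Real.log (n : ℝ) ^ 2 * n < (m : ℝ) ^ 2)
    (h1 : (n + a).choose (m - h) = n.choose m)
    (h2 : (n + a').choose (m - h') = n.choose m) : a * h' = a' * h := by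
  have hhh' : (h : ℝ) ≤ h' := by exact_mod_cast hhh
  have hm0 : (0 : ℝ) < m := by exact_mod_cast hm
  have hmn' : 2 * (m : ℝ) ≤ n := by exact_mod_cast hmn
  have hh0 : (0 : ℝ) ≤ h := by positivity
  have b1 : 2 * h ≤ m := by
    have : 2 * (h : ℝ) ≤ m := by linarith
    exact_mod_cast this
  have b2 : 2 * h' ≤ m := by
    have : 2 * (h' : ℝ) ≤ m := by linarith
    exact_mod_cast this
  obtain ⟨p1, q1⟩ := linear_form_bounds_of_choose_eq b1 hm hmn hlog1 (by nlinarith) h1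
  obtain ⟨p2, q2⟩ := linear_form_bounds_of_choose_eq b2 hm hmn hlog1 (by nlinarith) h2
  set ℓ := Real.log (n : ℝ)
  set L := Real.log ((n : ℝ) / (n - m)) with hL
  set D := Real.log (((n : ℝ) - m) / m)
  set B := 43 * H ^ 2 * ℓ ^ 2 / m with hB
  have hH0 : 0 ≤ H := by linarith
  have u1 : a * L - h * D ≤ B := q1.trans (by rw [hB]; gcongr; linarith)
  have u2 : a' * L - h' * D ≤ B := q2.trans (by rw [hB]; gcongr)
  have hB0 : 0 ≤ B := p1.trans u1
  have hLm : (m : ℝ) / n ≤ L := by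
    have hnm : (0 : ℝ) < n - m := by linarith
    have hn0 : (0 : ℝ) < n := by linarith
    have := Real.one_sub_inv_le_log_of_pos (show 0 < (n : ℝ) / (n - m) by positivity)
    refine le_trans (le_of_eq ?_) this
    rw [inv_div]; field_simp; ring
  have hid : ((a : ℝ) * h' - a' * h) * L = h' * (a * L - h * D) - h * (a' * L - h' * D) := by ring
  have habs : |((a : ℝ) * h' - a' * h) * L| ≤ H * B := by
    rw [hid]
    refine abs_sub_le_of_nonneg_of_le (by positivity) ?_ (by positivity) ?_
    · gcongr
    · gcongr; linarith
  have hn0 : (0 : ℝ) < n := by linarith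
  have hL0 : 0 < L := lt_of_lt_of_le (by positivity) hLm
  have hHB : H * B < m / n := by
    rw [hB, lt_div_iff₀ hn0, show H * (43 * H ^ 2 * ℓ ^ 2 / m) * n =
      43 * H ^ 3 * ℓ ^ 2 * n / m by ring, div_lt_iff₀ hm0]
    linarith
  have hlt : |((a : ℝ) * h' - a' * h)| < 1 := by
    rw [abs_mul, abs_of_pos hL0] at habs
    by_contra! hcon
    nlinarith
  have hz : |((a : ℤ) * h' - a' * h)| < 1 := by exact_mod_cast hlt
  have := Int.abs_lt_one_iff.1 hz
  have : (a : ℤ) * h' = a' * h := by linarith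
  exact_mod_cast this

theorem choose_lt_choose_left {k n n' : ℕ} (hk : 1 ≤ k) (hkn : k ≤ n) (hn : n < n') :
    n.choose k < n'.choose k := by
  refine lt_of_lt_of_le ?_ (Nat.choose_le_choose k (Nat.succ_le_of_lt hn))
  obtain ⟨k, rfl⟩ : ∃ j, k = j + 1 := ⟨k - 1, by omega⟩
  rw [Nat.succ_eq_add_one, Nat.choose_succ_succ']
  have := Nat.choose_pos (show k ≤ n by omega)
  omega

theorem choose_le_choose_of_le_half {n k m : ℕ} (hkm : k ≤ m) (hm : 2 * m ≤ n) :
    n.choose k ≤ n.choose m := by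
  induction m, hkm using Nat.le_induction with
  | base => exact le_rfl
  | succ m _ ih =>
    exact (ih (by omega)).trans (Nat.choose_le_succ_of_lt_half_left (by omega))

theorem le_of_choose_eq {n m n' m' : ℕ} (hm : 2 * m ≤ n) (hm' : 1 ≤ m') (hmn' : m' < n')
    (hle : m' ≤ m) (h : n'.choose m' = n.choose m) : n ≤ n' := by
  by_contra! hlt
  have h1 := choose_lt_choose_left hm' hmn'.le hlt
  have h2 := choose_le_choose_of_le_half hle hm
  omega

/-- Among solutions with lower index in `[m - H, m]`, two distinct ones besides `(n, m)` cannot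
coexist. -/
theorem false_of_two_choose_eq {n m n₁ m₁ n₂ m₂ : ℕ} {H : ℝ}
    (hHm : 2 * H ≤ m) (hm : 0 < m) (hmn : 2 * m ≤ n) (hlog1 : 1 ≤ Real.log (n : ℝ))
    (hlog : 4 * H * Real.log (n : ℝ) < m)
    (hbig : 43 * H ^ 3 * Real.log (n : ℝ) ^ 2 * n < (m : ℝ) ^ 2)
    (hm₂ : 1 ≤ m₂) (h21 : m₂ < m₁) (h1m : m₁ < m) (hm₁n : m₁ < n₁) (hm₂n : m₂ < n₂)
    (hH : (m : ℝ) - H ≤ m₂) (h₁ : n₁.choose m₁ = n.choose m)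
    (h₂ : n₂.choose m₂ = n.choose m) : False := by
  obtain ⟨a, rfl⟩ := Nat.exists_eq_add_of_le
    (le_of_choose_eq hmn (by omega) hm₁n h1m.le h₁)
  obtain ⟨a', rfl⟩ := Nat.exists_eq_add_of_le
    (le_of_choose_eq hmn hm₂ hm₂n (by omega) h₂)
  have e1 : m - (m - m₁) = m₁ := by omega
  have e2 : m - (m - m₂) = m₂ := by omega
  have hd : ((m - m₂ : ℕ) : ℝ) ≤ H := by
    rw [Nat.cast_sub (by omega)]; linarith
  refine not_collinear_of_choose_eq (n := n) (m := m) (a := a) (h := m - m₁) (a' := a')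
    (h' := m - m₂) (by omega) (by omega) (by omega) (by omega) (by rwa [e1]) (by rwa [e2]) ?_
  exact mul_eq_mul_of_choose_eq hd (by omega) hHm hm hmn hlog1 hlog hbig
    (by rwa [e1]) (by rwa [e2])

theorem exists_forall_log_le_rpow {ε : ℝ} (hε : 0 < ε) :
    ∃ n₀ : ℕ, ∀ n : ℕ, n₀ ≤ n → 1 ≤ Real.log (n : ℝ) ∧
      7 * Real.log (n : ℝ) ≤ (n : ℝ) ^ (ε / 10) := by
  have h1 := (isLittleO_log_rpow_atTop (show 0 < ε / 10 by positivity)).bound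
    (show (0 : ℝ) < 1 / 7 by norm_num)
  have h2 := Real.tendsto_log_atTop.eventually_ge_atTop 1
  obtain ⟨n₀, hn₀⟩ := Filter.eventually_atTop.1
    (tendsto_natCast_atTop_atTop.eventually (h1.and h2))
  refine ⟨n₀, fun n hn => ?_⟩
  obtain ⟨h3, h4⟩ := hn₀ n hn
  refine ⟨h4, ?_⟩
  rw [Real.norm_eq_abs, Real.norm_eq_abs, abs_of_nonneg (by linarith),
    abs_of_nonneg (by positivity)] at h3
  linarith


/-- Local count of solutions: for `0 < ε < 1` and `t` large, if `(n,m)` solves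
`C(n,m) = t` with `n^(1/2+ε) ≤ m ≤ n/2`, then there is at most one other solution
`(n',m')` with `m - m^(ε/10) ≤ m' ≤ m`. -/
theorem stmt_13 (ε : ℝ) (hε0 : 0 < ε) (hε1 : ε < 1) :
    ∃ t₀ : ℕ, ∀ t : ℕ, t₀ ≤ t → ∀ n m : ℕ,
      (n : ℝ) ^ ((1 : ℝ) / 2 + ε) ≤ (m : ℝ) → 2 * m ≤ n → Nat.choose n m = t →
      {q : ℕ × ℕ | q ≠ (n, m) ∧ 1 ≤ q.2 ∧ q.2 < q.1 ∧ Nat.choose q.1 q.2 = t ∧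
        (m : ℝ) - (m : ℝ) ^ (ε / 10) ≤ (q.2 : ℝ) ∧ q.2 ≤ m}.encard ≤ 1 := by
  obtain ⟨n₀, hn₀⟩ := exists_forall_log_le_rpow hε0
  refine ⟨2 ^ n₀, fun t ht n m hnm hmn hC => ?_⟩
  have hn : n₀ ≤ n := (Nat.pow_le_pow_iff_right (by norm_num : 1 < 2)).1
    (ht.trans (hC ▸ Nat.choose_le_two_pow n m))
  obtain ⟨hlog1, hlog7⟩ := hn₀ n hn
  set ℓ := Real.log (n : ℝ)
  set x := (n : ℝ) ^ (ε / 10) with hx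
  set H := (m : ℝ) ^ (ε / 10) with hHdef
  have hnpos : 0 < n := Nat.pos_of_ne_zero fun h0 => by
    simp [ℓ, h0] at hlog1; linarith
  have hn1 : (1 : ℝ) ≤ n := by exact_mod_cast hnpos
  have hHx : H ≤ x := by
    have : (m : ℝ) ≤ n := by exact_mod_cast (show m ≤ n by omega)
    exact Real.rpow_le_rpow (by positivity) this (by positivity)
  have hH0 : 0 ≤ H := by positivity
  have hx7 : 7 ≤ x := by linarith
  have hpow : (n : ℝ) ^ ((1 : ℝ) / 2 + ε) = Real.sqrt n * x ^ 10 := by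
    rw [Real.rpow_add (by positivity), Real.sqrt_eq_rpow, hx, ← Real.rpow_natCast,
      ← Real.rpow_mul (by positivity)]
    congr 2
    norm_num
  rw [hpow] at hnm
  have hs1 : 1 ≤ Real.sqrt n := Real.one_le_sqrt.2 hn1
  have hx10 : x ^ 10 ≤ m := le_trans (le_mul_of_one_le_left (by positivity) hs1) hnm
  have hx2 : x ^ 2 ≤ x ^ 10 := pow_le_pow_right₀ (by linarith) (by norm_num)
  have hm0 : 0 < m := by
    have : (0 : ℝ) < m := lt_of_lt_of_le (by positivity) hx10
    exact_mod_cast this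
  have hHm : 2 * H ≤ m := by nlinarith
  have hHℓ : H * (7 * ℓ) ≤ x * x := mul_le_mul hHx hlog7 (by linarith) (by linarith)
  have hlog : 4 * H * ℓ < m := by nlinarith
  have hbig : 43 * H ^ 3 * ℓ ^ 2 * n < (m : ℝ) ^ 2 := by
    have hm2 : n * x ^ 20 ≤ (m : ℝ) ^ 2 := by
      calc n * x ^ 20 = (Real.sqrt n * x ^ 10) ^ 2 := by
            rw [mul_pow, Real.sq_sqrt (by positivity)]; ring
        _ ≤ _ := by gcongr
    have h5 : H ^ 3 * (7 * ℓ) ^ 2 ≤ x ^ 3 * x ^ 2 := by gcongr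
    have h6 : x ^ 5 ≤ x ^ 20 := pow_le_pow_right₀ (by linarith) (by norm_num)
    have h7 : 0 < x ^ 5 := by positivity
    have h8 : 43 * H ^ 3 * ℓ ^ 2 < x ^ 20 := by nlinarith
    exact (mul_lt_mul_of_pos_right h8 (by linarith)).trans_le (by linarith)
  rw [Set.encard_le_one_iff]
  have hlt : ∀ q : ℕ × ℕ, q ≠ (n, m) → 1 ≤ q.2 → q.2 < q.1 → Nat.choose q.1 q.2 = t →
      q.2 ≤ m → q.2 < m := by
    intro q hne h1 h2 h3 h4
    refine lt_of_le_of_ne h4 fun he => hne ?_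
    have hge := le_of_choose_eq hmn h1 h2 h4 (h3.trans hC.symm)
    refine Prod.ext (le_antisymm ?_ hge) he
    by_contra! hcon
    have := choose_lt_choose_left hm0 (by omega) hcon
    rw [he] at h3
    exact this.ne (hC.trans h3.symm)
  rintro q r ⟨q0, q1, q2, q3, q4, q5⟩ ⟨r0, r1, r2, r3, r4, r5⟩
  have hqm := hlt q q0 q1 q2 q3 q5
  have hrm := hlt r r0 r1 r2 r3 r5
  rcases lt_trichotomy q.2 r.2 with h | h | h
  · exact (false_of_two_choose_eq hHm hm0 hmn hlog1 hlog hbig q1 h hrm r2 q2 q4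
      (r3.trans hC.symm) (q3.trans hC.symm)).elim
  · refine Prod.ext ?_ h
    rw [← h] at r2 r3
    rcases lt_trichotomy q.1 r.1 with h' | h' | h'
    · have := choose_lt_choose_left q1 q2.le h'
      omega
    · exact h'
    · have := choose_lt_choose_left q1 r2.le h'
      omega
  · exact (false_of_two_choose_eq hHm hm0 hmn hlog1 hlog hbig r1 h hqm q2 r2 r4
      (q3.trans hC.symm) (r3.trans hC.symm)).elim
end

section
/- There is an absolute constant C such that for every integer t ≥ 2 and every two pairs of integers (n,m), (n',m') with 1 ≤ m ≤ n, 1 ≤ m' ≤ n', and (n)_m = (n')_{m'} = t, one has |m − m'| ≤ C·log(n + n'). -/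
/-- The binary digit sum of a number up to `N` is at most a constant times `log N`. -/
theorem sum_digits_two_le_log {k N : ℕ} (hN : 2 ≤ N) (hk : k ≤ N) :
    (((Nat.digits 2 k).sum : ℕ) : ℝ) ≤ 2 / Real.log 2 * Real.log N := by
  have hlen : (Nat.digits 2 k).sum ≤ (Nat.digits 2 k).length := by
    have h := List.sum_le_card_nsmul (Nat.digits 2 k) 1 fun d hd => by
      have := Nat.digits_lt_base (by norm_num : 1 < 2) hd
      omega
    simpa using h
  have hlog : (Nat.digits 2 k).sum ≤ Nat.log 2 N + 1 := by
    rcases Nat.eq_zero_or_pos k with rfl | hpos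
    · simp
    · rw [Nat.length_digits 2 k (by norm_num) hpos.ne'] at hlen
      have := Nat.log_mono_right (b := 2) hk
      omega
  have h2 : 0 < Real.log 2 := Real.log_pos (by norm_num)
  have hone : Real.log 2 ≤ Real.log N :=
    Real.log_le_log (by norm_num) (by exact_mod_cast hN)
  have hpow : (Nat.log 2 N : ℝ) * Real.log 2 ≤ Real.log N := by
    rw [← Real.log_pow]
    exact Real.log_le_log (by positivity)
      (by exact_mod_cast Nat.pow_log_le_self 2 (by omega : N ≠ 0))
  have hlog' : (((Nat.digits 2 k).sum : ℕ) : ℝ) ≤ Nat.log 2 N + 1 := by exact_mod_cast hlog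
  rw [div_mul_eq_mul_div, le_div_iff₀ h2]
  nlinarith

/-- Legendre's formula at the prime two for falling factorials. -/
theorem padicValNat_two_descFactorial_add_sum_digits {n m : ℕ} (hmn : m ≤ n) :
    padicValNat 2 (n.descFactorial m) + (Nat.digits 2 n).sum =
      m + (Nat.digits 2 (n - m)).sum := by
  have hval : padicValNat 2 n.factorial =
      padicValNat 2 (n - m).factorial + padicValNat 2 (n.descFactorial m) := by
    rw [← Nat.factorial_mul_descFactorial hmn]
    exact padicValNat.mul (Nat.factorial_ne_zero _)
      (fun h => absurd (Nat.descFactorial_eq_zero_iff_lt.mp h) (by omega))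
  have h1 := sub_one_mul_padicValNat_factorial (p := 2) n
  have h2 := sub_one_mul_padicValNat_factorial (p := 2) (n - m)
  have h3 := Nat.digit_sum_le 2 n
  have h4 := Nat.digit_sum_le 2 (n - m)
  omega

/-- Distance estimate for falling factorials, first part: there is an absolute constant
`C` such that any two solutions `(n,m)`, `(n',m')` of `(n)_m = (n')_{m'} = t` with
`1 ≤ m ≤ n`, `1 ≤ m' ≤ n'` satisfy `|m - m'| ≤ C log(n + n')`. -/
theorem stmt_16 :
    ∃ C : ℝ, ∀ t n m n' m' : ℕ, 2 ≤ t →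
      1 ≤ m → m ≤ n → 1 ≤ m' → m' ≤ n' →
      Nat.descFactorial n m = t → Nat.descFactorial n' m' = t →
      |(m : ℝ) - (m' : ℝ)| ≤ C * Real.log ((n : ℝ) + (n' : ℝ)) := by
  refine ⟨2 * (2 / Real.log 2), fun t n m n' m' _ hm hmn hm' hmn' ht ht' => ?_⟩
  have h := padicValNat_two_descFactorial_add_sum_digits hmn
  have h' := padicValNat_two_descFactorial_add_sum_digits hmn'
  rw [ht] at h
  rw [ht'] at h'
  have hN : 2 ≤ n + n' := by omega
  have b1 := sum_digits_two_le_log hN (show n ≤ n + n' by omega)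
  have b2 := sum_digits_two_le_log hN (show n' ≤ n + n' by omega)
  have b3 := sum_digits_two_le_log hN (show n - m ≤ n + n' by omega)
  have b4 := sum_digits_two_le_log hN (show n' - m' ≤ n + n' by omega)
  rw [Nat.cast_add] at b1 b2 b3 b4
  have e : (padicValNat 2 t : ℝ) + (Nat.digits 2 n).sum =
      m + (Nat.digits 2 (n - m)).sum := by exact_mod_cast h
  have e' : (padicValNat 2 t : ℝ) + (Nat.digits 2 n').sum =
      m' + (Nat.digits 2 (n' - m')).sum := by exact_mod_cast h'
  have p1 : (0 : ℝ) ≤ (Nat.digits 2 n).sum := Nat.cast_nonneg _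
  have p2 : (0 : ℝ) ≤ (Nat.digits 2 n').sum := Nat.cast_nonneg _
  have p3 : (0 : ℝ) ≤ (Nat.digits 2 (n - m)).sum := Nat.cast_nonneg _
  have p4 : (0 : ℝ) ≤ (Nat.digits 2 (n' - m')).sum := Nat.cast_nonneg _
  rw [abs_le]
  constructor <;> linarith
end

section
/- There exist absolute constants c₁ > 0 and c₂ > 0 such that for every real C > 1 there exists x₀(C) with the following property. Let t be real, and let g be a smooth real-valued function defined on {x > 0 : Γ(x+2) ≤ t} satisfying g(x) ≥ x and Γ(g(x)+1)/Γ(g(x)−x+1) = t for all such x. Then for every real m with m ≥ x₀(C), t ≥ x₀(C), and Γ(m+2) ≤ t: (1) c₁·t^{1/m} ≤ g(m) ≤ c₂·t^{1/m}; (2) if m ≤ g(m)/2, then c₁·g(m)·(log t)/m² ≤ −g'(m) ≤ c₂·g(m)·(log t)/m²; (3) if m ≤ g(m) − C·(log g(m))², then 0 < g''(m) ≤ c₂·( g(m)·((log t)/m²)² + C^{−1}·(log m)^{−3} ). -/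
open Real Set Filter Topology

/-- The derivative of `log Γ` on the real line. -/
noncomputable def psi : ℝ → ℝ := deriv fun x => log (Gamma x)

lemma contDiffAt_log_Gamma {x : ℝ} (hx : 0 < x) :
    ContDiffAt ℝ 2 (fun x => log (Gamma x)) x := by
  have hopen : IsOpen {z : ℂ | 0 < z.re} := isOpen_lt continuous_const Complex.continuous_re
  have hdiff : DifferentiableOn ℂ Complex.Gamma {z : ℂ | 0 < z.re} := fun z hz =>
    (Complex.differentiableAt_Gamma z fun m h => by
      have h' : (0 : ℝ) < z.re := hz
      rw [h] at h'
      simp only [Complex.neg_re, Complex.natCast_re] at h'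
      have : (0 : ℝ) ≤ m := m.cast_nonneg
      linarith).differentiableWithinAt
  have han : ContDiffAt ℂ 2 Complex.Gamma (x : ℂ) :=
    (hdiff.analyticAt (hopen.mem_nhds (by simpa using hx))).contDiffAt
  have hG : ContDiffAt ℝ 2 Gamma x := han.real_of_complex
  exact hG.log (Gamma_pos_of_pos hx).ne'

lemma hasDerivAt_log_Gamma {x : ℝ} (hx : 0 < x) :
    HasDerivAt (fun x => log (Gamma x)) (psi x) x :=
  ((contDiffAt_log_Gamma hx).differentiableAt (by norm_num)).hasDerivAt

lemma hasDerivAt_psi {x : ℝ} (hx : 0 < x) : HasDerivAt psi (deriv psi x) x := by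
  have h2 : ContDiffOn ℝ 2 (fun x => log (Gamma x)) (Ioi 0) := fun y hy =>
    (contDiffAt_log_Gamma hy).contDiffWithinAt
  have h1 : ContDiffOn ℝ 1 psi (Ioi 0) := h2.deriv_of_isOpen isOpen_Ioi (by norm_num)
  exact ((h1.contDiffAt (Ioi_mem_nhds hx)).differentiableAt (by norm_num)).hasDerivAt

lemma log_Gamma_add_one {x : ℝ} (hx : 0 < x) :
    log (Gamma (x + 1)) = log (Gamma x) + log x := by
  rw [Gamma_add_one hx.ne', log_mul hx.ne' (Gamma_pos_of_pos hx).ne', add_comm]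

lemma psi_add_one {x : ℝ} (hx : 0 < x) : psi (x + 1) = psi x + 1 / x := by
  have h1 : HasDerivAt (fun y => log (Gamma (y + 1))) (psi (x + 1)) x :=
    (hasDerivAt_log_Gamma (by linarith : 0 < x + 1)).comp_add_const x 1
  have h2 : HasDerivAt (fun y => log (Gamma y) + log y) (psi x + x⁻¹) x :=
    (hasDerivAt_log_Gamma hx).add (hasDerivAt_log hx.ne')
  have h3 : (fun y => log (Gamma y) + log y) =ᶠ[𝓝 x] fun y => log (Gamma (y + 1)) := by
    filter_upwards [lt_mem_nhds hx] with y hy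
    exact (log_Gamma_add_one hy).symm
  rw [one_div]
  exact h1.unique (h2.congr_of_eventuallyEq h3.symm)

lemma psi_le_log {x : ℝ} (hx : 0 < x) : psi x ≤ log x := by
  have h := convexOn_log_Gamma.le_slope_of_hasDerivAt (mem_Ioi.2 hx)
    (mem_Ioi.2 (by linarith : 0 < x + 1)) (by linarith) (hasDerivAt_log_Gamma hx)
  simpa [slope_def_field, log_Gamma_add_one hx] using h

lemma log_le_psi_add_one {x : ℝ} (hx : 0 < x) : log x ≤ psi (x + 1) := by
  have h := convexOn_log_Gamma.slope_le_of_hasDerivAt (mem_Ioi.2 hx)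
    (mem_Ioi.2 (by linarith : 0 < x + 1)) (by linarith)
    (hasDerivAt_log_Gamma (by linarith : 0 < x + 1))
  simpa [slope_def_field, log_Gamma_add_one hx] using h

lemma psi_add_nat {x : ℝ} (hx : 0 < x) (n : ℕ) :
    psi (x + n) = psi x + ∑ k ∈ Finset.range n, 1 / (x + k) := by
  induction n with
  | zero => simp
  | succ n ih =>
    rw [Finset.sum_range_succ, Nat.cast_succ, ← add_assoc, psi_add_one (by positivity), ih,
      add_assoc]

lemma tendsto_psi {x : ℝ} (hx : 0 < x) :
    Tendsto (fun n : ℕ => log n - ∑ k ∈ Finset.range n, 1 / (x + k)) atTop (𝓝 (psi x)) := by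
  have hup : Tendsto (fun n : ℕ => 1 / (n : ℝ)) atTop (𝓝 0) := tendsto_one_div_atTop_nhds_zero_nat
  have hlim : Tendsto (fun n : ℕ => psi (x + n) - log n) atTop (𝓝 0) := by
    have hl : Tendsto (fun n : ℕ => -(1 / (n : ℝ))) atTop (𝓝 0) := by simpa using hup.neg
    have hu : Tendsto (fun n : ℕ => x * (1 / (n : ℝ))) atTop (𝓝 0) := by
      simpa using hup.const_mul x
    refine tendsto_of_tendsto_of_tendsto_of_le_of_le' hl hu ?_ ?_
    · filter_upwards [eventually_gt_atTop 0] with n hn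
      have hn' : (0 : ℝ) < n := by exact_mod_cast hn
      have hxn : 0 < x + n := by positivity
      have h1 := log_le_psi_add_one hxn
      rw [psi_add_one hxn] at h1
      have h2 : log n ≤ log (x + n) := log_le_log hn' (by linarith)
      have h3 : 1 / (x + n) ≤ 1 / n := one_div_le_one_div_of_le hn' (by linarith)
      linarith
    · filter_upwards [eventually_gt_atTop 0] with n hn
      have hn' : (0 : ℝ) < n := by exact_mod_cast hn
      have h1 := psi_le_log (by positivity : 0 < x + n)
      have h2 : log (x + n) - log n ≤ x * (1 / n) := by
        rw [← log_div (by positivity) hn'.ne']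
        refine (log_le_sub_one_of_pos (by positivity)).trans (le_of_eq ?_)
        field_simp
        ring
      linarith
  have := (tendsto_const_nhds (x := psi x)).sub hlim
  rw [sub_zero] at this
  refine this.congr fun n => ?_
  rw [psi_add_nat hx]
  ring

lemma concaveOn_psi : ConcaveOn ℝ (Ioi 0) psi := by
  refine ⟨convex_Ioi 0, fun x hx y hy a b ha hb hab => ?_⟩
  have hx' : 0 < x := hx
  have hy' : 0 < y := hy
  have hz : 0 < a • x + b • y := (convex_Ioi (0 : ℝ)) hx hy ha hb hab
  refine le_of_tendsto_of_tendsto' (((tendsto_psi hx').const_smul a).add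
    ((tendsto_psi hy').const_smul b)) (tendsto_psi hz) fun n => ?_
  have key : ∑ k ∈ Finset.range n, 1 / (a • x + b • y + k) ≤
      a * ∑ k ∈ Finset.range n, 1 / (x + k) + b * ∑ k ∈ Finset.range n, 1 / (y + k) := by
    rw [Finset.mul_sum, Finset.mul_sum, ← Finset.sum_add_distrib]
    refine Finset.sum_le_sum fun k _ => ?_
    have h := (convexOn_zpow (𝕜 := ℝ) (-1)).2 (mem_Ioi.2 (by positivity : 0 < x + k))
      (mem_Ioi.2 (by positivity : 0 < y + k)) ha hb hab
    simp only [smul_eq_mul, zpow_neg_one, ← one_div] at h ⊢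
    have e : a * (x + k) + b * (y + k) = a * x + b * y + k := by linear_combination (k : ℝ) * hab
    rwa [e] at h
  have e : a * log n + b * log n = log n := by rw [← add_mul, hab, one_mul]
  simp only [smul_eq_mul] at key ⊢
  linarith

lemma deriv_psi_add_one_le {x : ℝ} (hx : 0 < x) : deriv psi (x + 1) ≤ 1 / x := by
  have h := concaveOn_psi.le_slope_of_hasDerivAt (mem_Ioi.2 hx)
    (mem_Ioi.2 (by linarith : 0 < x + 1)) (by linarith) (hasDerivAt_psi (by linarith : 0 < x + 1))
  simpa [slope_def_field, psi_add_one hx] using h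

lemma one_div_le_deriv_psi {x : ℝ} (hx : 0 < x) : 1 / x ≤ deriv psi x := by
  have h := concaveOn_psi.slope_le_of_hasDerivAt (mem_Ioi.2 hx)
    (mem_Ioi.2 (by linarith : 0 < x + 1)) (by linarith) (hasDerivAt_psi hx)
  simpa [slope_def_field, psi_add_one hx] using h

lemma mul_log_sub_le_log_Gamma_add_one {x : ℝ} (hx : 1 ≤ x) :
    x * log x - x ≤ log (Gamma (x + 1)) := by
  have hd : ∀ y : ℝ, 0 < y → HasDerivAt (fun y => log (Gamma (y + 1)) - (y * log y - y))
      (psi (y + 1) - (1 * log y + y * y⁻¹ - 1)) y := fun y hy =>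
    ((hasDerivAt_log_Gamma (by linarith : 0 < y + 1)).comp_add_const y 1).sub
      (((hasDerivAt_id y).mul (hasDerivAt_log hy.ne')).sub (hasDerivAt_id y))
  have hmono : MonotoneOn (fun y => log (Gamma (y + 1)) - (y * log y - y)) (Ici 1) := by
    refine monotoneOn_of_deriv_nonneg (convex_Ici 1) (fun y hy => ?_) (fun y hy => ?_)
      fun y hy => ?_
    · exact (hd y (by linarith [mem_Ici.1 hy])).continuousAt.continuousWithinAt
    · rw [interior_Ici] at hy
      exact (hd y (by linarith [mem_Ioi.1 hy])).differentiableAt.differentiableWithinAt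
    · rw [interior_Ici] at hy
      have hy0 : 0 < y := by linarith [mem_Ioi.1 hy]
      rw [(hd y hy0).deriv, mul_inv_cancel₀ hy0.ne']
      linarith [log_le_psi_add_one hy0]
  have h := hmono (mem_Ici.2 le_rfl) (mem_Ici.2 hx) hx
  have h2 : Gamma (1 + 1) = 1 := by norm_num
  simp only [h2, log_one] at h
  linarith

/-- With `n ≥ m`, the logarithm of the falling factorial `(n)_m` is `m log n + O(m)`. -/
lemma log_Gamma_sub_bounds {m n : ℝ} (hm : 1 ≤ m) (hmn : m ≤ n) :
    m * (log n - 1) ≤ log (Gamma (n + 1)) - log (Gamma (n - m + 1)) ∧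
      log (Gamma (n + 1)) - log (Gamma (n - m + 1)) ≤ m * log (n + 1) := by
  have hn : 0 < n := by linarith
  have hm0 : 0 < m := by linarith
  have ha : n - m + 1 ∈ Ioi (0 : ℝ) := mem_Ioi.2 (by linarith)
  have hb : n + 1 ∈ Ioi (0 : ℝ) := mem_Ioi.2 (by linarith)
  constructor
  · have h1 := mul_log_sub_le_log_Gamma_add_one (hm.trans hmn)
    have h2 : log (Gamma (n + 1)) / n ≤
        (log (Gamma (n + 1)) - log (Gamma (n - m + 1))) / m := by
      have h := convexOn_log_Gamma.secant_mono hb (mem_Ioi.2 one_pos) ha (by linarith)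
        (by linarith) (by linarith)
      rw [← neg_div_neg_eq, ← neg_div_neg_eq (_ - _) (n - m + 1 - (n + 1))] at h
      simpa using h
    rw [div_le_div_iff₀ hn hm0] at h2
    have h3 : (m * (log n - 1)) * n ≤
        (log (Gamma (n + 1)) - log (Gamma (n - m + 1))) * n := by
      nlinarith
    exact le_of_mul_le_mul_right h3 hn
  · have h := convexOn_log_Gamma.slope_le_of_hasDerivAt ha hb (by linarith)
      (hasDerivAt_log_Gamma hb)
    rw [slope_def_field, div_le_iff₀ (by linarith)] at h
    have h2 := psi_le_log hb
    simp only [Function.comp] at h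
    nlinarith

lemma psi_sub_psi_bounds {m n : ℝ} (hm : 1 ≤ m) (hmn : m < n) :
    log (n / (n - m + 1)) ≤ psi (n + 1) - psi (n - m + 1) ∧
      psi (n + 1) - psi (n - m + 1) ≤ (m + 1) / (n - m) := by
  have hn : 0 < n := by linarith
  have hnm : 0 < n - m := by linarith
  have h1 := log_le_psi_add_one hn
  have h2 := psi_le_log (by linarith : 0 < n - m + 1)
  have h3 := psi_le_log (by linarith : 0 < n + 1)
  have h4 := log_le_psi_add_one hnm
  have h5 : log ((n + 1) / (n - m)) ≤ (m + 1) / (n - m) := by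
    refine (log_le_sub_one_of_pos (by positivity)).trans (le_of_eq ?_)
    field_simp
    ring
  rw [log_div (by linarith) (by linarith)] at h5 ⊢
  constructor <;> linarith

lemma Gamma_lt_of_log_Gamma_sub_eq {m n t : ℝ} (hm : 1 < m) (hmn : m + 1 < n) (ht : 0 < t)
    (h : log (Gamma (n + 1)) - log (Gamma (n - m + 1)) = log t) : Gamma (m + 2) < t := by
  have hd : ∀ s : ℝ, 0 ≤ s →
      HasDerivAt (fun s => log (Gamma (m + 2 + s)) - log (Gamma (2 + s)))
        (psi (m + 2 + s) - psi (2 + s)) s := fun s hs =>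
    ((hasDerivAt_log_Gamma (by linarith : 0 < m + 2 + s)).comp_const_add (m + 2) s).sub
      ((hasDerivAt_log_Gamma (by linarith : 0 < 2 + s)).comp_const_add 2 s)
  have hmono : StrictMonoOn (fun s => log (Gamma (m + 2 + s)) - log (Gamma (2 + s))) (Ici 0) := by
    refine strictMonoOn_of_deriv_pos (convex_Ici 0)
      (fun s hs => (hd s hs).continuousAt.continuousWithinAt) fun s hs => ?_
    rw [interior_Ici] at hs
    have hs0 : 0 < s := hs
    rw [(hd s hs0.le).deriv]
    have h1 := log_le_psi_add_one (by linarith : 0 < m + 1 + s)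
    have h2 := psi_le_log (by linarith : 0 < 2 + s)
    have h3 : log (2 + s) < log (m + 1 + s) := log_lt_log (by linarith) (by linarith)
    rw [show m + 1 + s + 1 = m + 2 + s by ring] at h1
    linarith
  have h1 := hmono (mem_Ici.2 le_rfl) (mem_Ici.2 (by linarith : 0 ≤ n - m - 1)) (by linarith)
  simp only [add_zero, Gamma_two, log_one, sub_zero] at h1
  rw [show m + 2 + (n - m - 1) = n + 1 by ring, show 2 + (n - m - 1) = n - m + 1 by ring, h] at h1
  exact (log_lt_log_iff (Gamma_pos_of_pos (by linarith)) ht).1 h1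

lemma eventually_Gamma_add_two_le {m t : ℝ} (hm : 0 < m) (h : Gamma (m + 2) < t) :
    ∀ᶠ x in 𝓝 m, x ∈ {x : ℝ | 0 < x ∧ Gamma (x + 2) ≤ t} := by
  have hc : ContinuousAt (fun x => Gamma (x + 2)) m := by
    refine ContinuousAt.comp (g := Gamma) (f := fun x => x + 2) ?_ (by fun_prop)
    exact (differentiableAt_Gamma fun k hk => by
      have : (0 : ℝ) ≤ k := k.cast_nonneg
      linarith).continuousAt
  filter_upwards [lt_mem_nhds hm, hc.eventually_lt continuousAt_const h] with x hx hx'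
  exact ⟨hx, hx'.le⟩

lemma psi_sub_psi_mul_deriv {g : ℝ → ℝ} {x T : ℝ} (hx : 0 < x) (hg : DifferentiableAt ℝ g x)
    (h : ∀ᶠ y in 𝓝 x, y ≤ g y ∧ log (Gamma (g y + 1)) - log (Gamma (g y - y + 1)) = T) :
    (psi (g x + 1) - psi (g x - x + 1)) * deriv g x + psi (g x - x + 1) = 0 := by
  have hx2 := h.self_of_nhds.1
  have h1 : HasDerivAt (fun y => log (Gamma (g y + 1)) - log (Gamma (g y - y + 1)))
      (psi (g x + 1) * deriv g x - psi (g x - x + 1) * (deriv g x - 1)) x := by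
    refine HasDerivAt.sub ?_ ?_
    · exact (hasDerivAt_log_Gamma (by linarith : 0 < g x + 1)).comp x (hg.hasDerivAt.add_const 1)
    · exact (hasDerivAt_log_Gamma (by linarith : 0 < g x - x + 1)).comp x
        ((hg.hasDerivAt.sub (hasDerivAt_id x)).add_const 1)
  have h2 : HasDerivAt (fun y => log (Gamma (g y + 1)) - log (Gamma (g y - y + 1))) 0 x :=
    (hasDerivAt_const x T).congr_of_eventuallyEq (h.mono fun y hy => hy.2)
  linear_combination h1.unique h2

lemma psi_sub_psi_mul_deriv_deriv {g : ℝ → ℝ} {x T : ℝ} (hx : 0 < x) (hg : ContDiffAt ℝ 2 g x)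
    (h : ∀ᶠ y in 𝓝 x, y ≤ g y ∧ log (Gamma (g y + 1)) - log (Gamma (g y - y + 1)) = T) :
    (psi (g x + 1) - psi (g x - x + 1)) * deriv (deriv g) x =
      deriv psi (g x - x + 1) * (1 - deriv g x) ^ 2 - deriv psi (g x + 1) * deriv g x ^ 2 := by
  have hx2 := h.self_of_nhds.1
  have hev : ∀ᶠ y in 𝓝 x, ContDiffAt ℝ 2 g y := hg.eventually (by norm_num)
  have hg1 : DifferentiableAt ℝ g x := hg.differentiableAt (by norm_num)
  have hg2 : DifferentiableAt ℝ (deriv g) x := by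
    obtain ⟨u, hu, hxo, hcd⟩ := mem_nhds_iff.1 hev
    have h2 : ContDiffOn ℝ 2 g u := fun y hy => ContDiffAt.contDiffWithinAt (show ContDiffAt ℝ 2 g y from hu hy)
    have h1 : ContDiffOn ℝ 1 (deriv g) u := h2.deriv_of_isOpen hxo (by norm_num)
    exact (h1.contDiffAt (hxo.mem_nhds hcd)).differentiableAt (by norm_num)
  have hA : HasDerivAt (fun y => psi (g y + 1)) (deriv psi (g x + 1) * deriv g x) x :=
    (hasDerivAt_psi (by linarith : 0 < g x + 1)).comp x (hg1.hasDerivAt.add_const 1)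
  have hB : HasDerivAt (fun y => psi (g y - y + 1))
      (deriv psi (g x - x + 1) * (deriv g x - 1)) x :=
    (hasDerivAt_psi (by linarith : 0 < g x - x + 1)).comp x
      ((hg1.hasDerivAt.sub (hasDerivAt_id x)).add_const 1)
  have h1 := ((hA.sub hB).mul hg2.hasDerivAt).add hB
  have h0 : (fun y => (psi (g y + 1) - psi (g y - y + 1)) * deriv g y + psi (g y - y + 1))
      =ᶠ[𝓝 x] fun _ => 0 := by
    filter_upwards [h.eventually_nhds, hev, lt_mem_nhds hx] with y hy hy2 hy0
    exact psi_sub_psi_mul_deriv hy0 (hy2.differentiableAt (by norm_num)) hy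
  have h2 := (hasDerivAt_const x (0 : ℝ)).congr_of_eventuallyEq h0
  have h3 := h1.unique h2
  simp only [Pi.sub_apply] at h3
  linear_combination h3

lemma second_deriv_bound_of_two_mul_le {m n l r P Q p q G : ℝ} (hm : 0 < m) (hn : 0 < n)
    (hl : 1 ≤ l) (hP : 0 ≤ P) (hPl : P ≤ l) (hQ : Q ≤ 2 * l)
    (hD1 : m / (2 * n) ≤ Q - P) (hD2 : Q - P ≤ 4 * m / n) (hp : p ≤ 2 / n)
    (hpq : p - q ≤ 4 * m / n ^ 2) (hlr : l ≤ 2 * r)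
    (hG : (Q - P) ^ 3 * G = p * Q ^ 2 - q * P ^ 2) :
    G ≤ 896 * (n * (r / m) ^ 2) := by
  have hD0 : 0 < Q - P := lt_of_lt_of_le (by positivity) hD1
  have h1 : p * ((Q - P) * (Q + P)) ≤ 2 / n * (4 * m / n * (3 * l)) :=
    mul_le_mul hp (mul_le_mul hD2 (by linarith) (by linarith) (by positivity))
      (mul_nonneg hD0.le (by linarith)) (by positivity)
  have h2 : (p - q) * P ^ 2 ≤ 4 * m / n ^ 2 * l ^ 2 :=
    (mul_le_mul_of_nonneg_right hpq (sq_nonneg P)).trans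
      (mul_le_mul_of_nonneg_left (pow_le_pow_left₀ hP hPl 2) (by positivity))
  have h3 : 2 / n * (4 * m / n * (3 * l)) ≤ 24 * m / n ^ 2 * l ^ 2 := by
    rw [show 2 / n * (4 * m / n * (3 * l)) = 24 * m / n ^ 2 * l by field_simp; ring]
    exact mul_le_mul_of_nonneg_left (by nlinarith) (by positivity)
  have h4 : (Q - P) ^ 3 * G ≤ 28 * m / n ^ 2 * l ^ 2 := by
    rw [show 28 * m / n ^ 2 * l ^ 2 = 24 * m / n ^ 2 * l ^ 2 + 4 * m / n ^ 2 * l ^ 2 by ring]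
    linarith
  have h5 : (m / (2 * n)) ^ 3 ≤ (Q - P) ^ 3 := pow_le_pow_left₀ (by positivity) hD1 3
  rcases le_or_gt G 0 with h | h
  · exact h.trans (by positivity)
  have h6 : (m / (2 * n)) ^ 3 * G ≤ 28 * m / n ^ 2 * l ^ 2 :=
    (mul_le_mul_of_nonneg_right h5 h.le).trans h4
  have h7 : l ^ 2 ≤ 4 * r ^ 2 := by nlinarith
  have h8 : 28 * m / n ^ 2 * l ^ 2 ≤ (m / (2 * n)) ^ 3 * (896 * (n * (r / m) ^ 2)) := by
    rw [show (m / (2 * n)) ^ 3 * (896 * (n * (r / m) ^ 2)) = 28 * m / n ^ 2 * (4 * r ^ 2) by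
      field_simp; ring]
    exact mul_le_mul_of_nonneg_left h7 (by positivity)
  exact le_of_mul_le_mul_left (h6.trans h8) (by positivity)

lemma second_deriv_bound_of_le {P Q p q G l c d : ℝ} (hd : 0 < d) (hD : d ≤ Q - P)
    (hP : 0 ≤ P) (hQ : Q ≤ 2 * l) (hp : p ≤ c) (hp0 : 0 ≤ p) (hq : 0 ≤ q)
    (hG : (Q - P) ^ 3 * G = p * Q ^ 2 - q * P ^ 2) :
    G ≤ 4 * c * l ^ 2 / d ^ 3 := by
  have h1 : p * Q ^ 2 ≤ c * (2 * l) ^ 2 :=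
    mul_le_mul hp (pow_le_pow_left₀ (by linarith) hQ 2) (by positivity) (by linarith)
  have h2 : 0 ≤ q * P ^ 2 := by positivity
  have h3 : d ^ 3 ≤ (Q - P) ^ 3 := pow_le_pow_left₀ hd.le hD 3
  have hc : 0 ≤ c := hp0.trans hp
  rw [le_div_iff₀ (by positivity)]
  rcases le_or_gt G 0 with h | h
  · exact (mul_nonpos_of_nonpos_of_nonneg h (by positivity)).trans (by positivity)
  · nlinarith

lemma exists_forall_log_pow_le (C : ℝ) :
    ∃ x₀ : ℝ, 100 ≤ x₀ ∧ ∀ n, x₀ ≤ n → 4 ≤ log n ∧ 4 * C ^ 2 * log n ^ 10 ≤ n := by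
  have h1 : ∀ᶠ n : ℝ in atTop, 4 ≤ log n := tendsto_log_atTop.eventually_ge_atTop 4
  have h2 : ∀ᶠ n : ℝ in atTop, ‖log n ^ 10‖ ≤ (1 / (4 * C ^ 2 + 1)) * ‖id n‖ :=
    (isLittleO_pow_log_id_atTop (n := 10)).bound (by positivity)
  obtain ⟨x₀, hx₀⟩ := eventually_atTop.1 ((h1.and h2).and (eventually_gt_atTop 0))
  refine ⟨max 100 x₀, le_max_left _ _, fun n hn => ?_⟩
  obtain ⟨⟨h3, h4⟩, h5⟩ := hx₀ n ((le_max_right _ _).trans hn)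
  refine ⟨h3, ?_⟩
  have h6 : 0 ≤ log n ^ 10 := by positivity
  rw [norm_of_nonneg h6, id, norm_of_nonneg h5.le, one_div, inv_mul_eq_div,
    le_div_iff₀ (by positivity)] at h4
  linarith

lemma log_le_psi_le_log {m n : ℝ} (hm : 1 ≤ m) (h : m < n) :
    log (n - m) ≤ psi (n - m + 1) ∧ psi (n - m + 1) ≤ log n :=
  ⟨log_le_psi_add_one (by linarith), (psi_le_log (by linarith)).trans
    (log_le_log (by linarith) (by linarith))⟩

lemma psi_sub_psi_bounds_of_two_mul_le {m n : ℝ} (hm : 2 ≤ m) (h : 2 * m ≤ n) :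
    m / (2 * n) ≤ psi (n + 1) - psi (n - m + 1) ∧
      psi (n + 1) - psi (n - m + 1) ≤ 4 * m / n := by
  have hn0 : 0 < n := by linarith
  obtain ⟨h1, h2⟩ := psi_sub_psi_bounds (by linarith : 1 ≤ m) (by linarith : m < n)
  constructor
  · refine le_trans ?_ h1
    have h3 := one_sub_inv_le_log_of_pos (div_pos hn0 (by linarith : 0 < n - m + 1))
    refine le_trans ?_ h3
    rw [inv_div, one_sub_div hn0.ne', div_le_div_iff₀ (by linarith) hn0]
    nlinarith
  · refine h2.trans ?_
    rw [div_le_div_iff₀ (by linarith) hn0]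
    nlinarith

lemma second_deriv_bounds {C m n r d G : ℝ} (hC : 1 < C) (hm : 100 ≤ m) (hlr : log n ≤ 2 * r)
    (hl4 : 4 ≤ log n) (hbign : 4 * C ^ 2 * log n ^ 10 ≤ n) (hC2 : m ≤ n - C * log n ^ 2)
    (hg1 : (psi (n + 1) - psi (n - m + 1)) * d + psi (n - m + 1) = 0)
    (hg2 : (psi (n + 1) - psi (n - m + 1)) * G =
      deriv psi (n - m + 1) * (1 - d) ^ 2 - deriv psi (n + 1) * d ^ 2) :
    0 < G ∧ G ≤ 1000 * (n * (r / m) ^ 2 + C⁻¹ / log m ^ 3) := by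
  have hm0 : 0 < m := by linarith
  have hmn : m ≤ n := by nlinarith
  have hn0 : 0 < n := by linarith
  have hlogm : log m ≤ log n := log_le_log hm0 hmn
  have hlogm0 : 0 < log m := log_pos (by linarith)
  have hlog_n1 : log (n + 1) ≤ log n + log 2 := by
    rw [← log_mul hn0.ne' two_ne_zero]
    exact log_le_log (by linarith) (by linarith)
  have hlog2 : log 2 < 1 := by linarith [log_two_lt_d9]
  set l := log n with hl_def
  have hCl : 16 ≤ C * l ^ 2 := by nlinarith
  have hnm : C * l ^ 2 ≤ n - m := by linarith
  have hmn' : m < n := by linarith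
  have hnm0 : 0 < n - m := by linarith
  obtain ⟨hP1, hP2⟩ := log_le_psi_le_log (by linarith) hmn'
  obtain ⟨hD1, -⟩ := psi_sub_psi_bounds (by linarith : 1 ≤ m) hmn'
  have hp1 := deriv_psi_add_one_le hnm0
  have hp2 := one_div_le_deriv_psi (by linarith : 0 < n - m + 1)
  have hq1 := deriv_psi_add_one_le hn0
  have hq2 := one_div_le_deriv_psi (by linarith : 0 < n + 1)
  have hQ : psi (n + 1) ≤ 2 * l := (psi_le_log (by linarith)).trans (by linarith)
  have hDpos : 0 < log (n / (n - m + 1)) := by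
    refine log_pos ?_
    rw [one_lt_div (by linarith)]
    linarith
  have hP0 : 0 ≤ psi (n - m + 1) := (log_nonneg (by linarith)).trans hP1
  have hpq : deriv psi (n + 1) ≤ deriv psi (n - m + 1) :=
    hq1.trans ((one_div_le_one_div_of_le (by linarith) (by linarith)).trans hp2)
  have hp0 : 0 < deriv psi (n - m + 1) :=
    lt_of_lt_of_le (one_div_pos.2 (by linarith)) hp2
  have hq0 : 0 < deriv psi (n + 1) :=
    lt_of_lt_of_le (one_div_pos.2 (by linarith)) hq2
  have hpq2 : deriv psi (n - m + 1) - deriv psi (n + 1) ≤ (m + 1) / ((n - m) * (n + 1)) := by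
    have e : (m + 1) / ((n - m) * (n + 1)) = 1 / (n - m) - 1 / (n + 1) := by
      field_simp
      ring
    rw [e]
    linarith
  set P := psi (n - m + 1)
  set Q := psi (n + 1)
  set p := deriv psi (n - m + 1)
  set q := deriv psi (n + 1)
  have hD0 : 0 < Q - P := hDpos.trans_le hD1
  have hG : (Q - P) ^ 3 * G = p * Q ^ 2 - q * P ^ 2 := by
    have e1 : (Q - P) * d = -P := by linear_combination hg1
    have e2 : (Q - P) * (1 - d) = Q := by linear_combination -hg1
    calc (Q - P) ^ 3 * G = (Q - P) ^ 2 * ((Q - P) * G) := by ring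
      _ = p * ((Q - P) * (1 - d)) ^ 2 - q * ((Q - P) * d) ^ 2 := by
        rw [hg2]; ring
      _ = _ := by rw [e1, e2]; ring
  constructor
  · have h1 : q * P ^ 2 ≤ p * P ^ 2 := mul_le_mul_of_nonneg_right hpq (sq_nonneg P)
    have h2 : p * P ^ 2 < p * Q ^ 2 :=
      mul_lt_mul_of_pos_left (pow_lt_pow_left₀ (by linarith) hP0 two_ne_zero) hp0
    have h3 : 0 < (Q - P) ^ 3 * G := by linarith
    exact pos_of_mul_pos_right h3 (by positivity)
  have hterm1 : 0 ≤ n * (r / m) ^ 2 := by positivity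
  have hterm2 : C⁻¹ / l ^ 3 ≤ C⁻¹ / log m ^ 3 :=
    div_le_div_of_nonneg_left (by positivity) (by positivity)
      (pow_le_pow_left₀ hlogm0.le hlogm 3)
  have hterm3 : 0 ≤ C⁻¹ / l ^ 3 := by positivity
  rcases le_or_gt (2 * m) n with h2m | h2m
  · obtain ⟨hD2, hD3⟩ := psi_sub_psi_bounds_of_two_mul_le (by linarith) h2m
    have hpn : p ≤ 2 / n := hp1.trans (by
      rw [div_le_div_iff₀ hnm0 hn0]
      linarith)
    have hpqn : p - q ≤ 4 * m / n ^ 2 := hpq2.trans (by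
      rw [div_le_div_iff₀ (by positivity) (by positivity)]
      have h1 : n * n ≤ (n - m) * 2 * (n + 1) := mul_le_mul (by linarith) (by linarith)
        hn0.le (by linarith)
      nlinarith)
    have h := second_deriv_bound_of_two_mul_le (r := r) hm0 hn0 (by linarith) hP0 hP2 hQ hD2 hD3
      hpn hpqn (by linarith) hG
    linarith
  · rcases le_or_gt (C * l ^ 5) (n - m) with h5 | h5
    · have hd : 1 / 3 ≤ Q - P := by
        refine le_trans ?_ hD1
        have h3 := one_sub_inv_le_log_of_pos (div_pos hn0 (by linarith : 0 < n - m + 1))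
        refine le_trans ?_ h3
        rw [inv_div, one_sub_div hn0.ne', div_le_div_iff₀ (by linarith) hn0]
        linarith
      have h := second_deriv_bound_of_le (c := 1 / (C * l ^ 5)) (by norm_num) hd hP0 hQ
        (hp1.trans (one_div_le_one_div_of_le (by positivity) h5)) hp0.le hq0.le hG
      have e : 4 * (1 / (C * l ^ 5)) * l ^ 2 / (1 / 3) ^ 3 = 108 * (C⁻¹ / l ^ 3) := by
        field_simp
        norm_num
      rw [e] at h
      linarith
    · have hd : l / 2 ≤ Q - P := by
        refine le_trans ?_ hD1
        have h6 : (n - m + 1) ^ 2 ≤ n := by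
          have : n - m + 1 ≤ 2 * (C * l ^ 5) := by
            have : 1 ≤ C * l ^ 5 := by linarith
            linarith
          calc (n - m + 1) ^ 2 ≤ (2 * (C * l ^ 5)) ^ 2 := pow_le_pow_left₀ (by linarith) this 2
            _ = 4 * C ^ 2 * l ^ 10 := by ring
            _ ≤ n := hbign
        have h7 := log_le_log (by positivity) h6
        rw [log_pow, ← hl_def] at h7
        rw [log_div hn0.ne' (by linarith), ← hl_def]
        push_cast at h7
        linarith
      have h := second_deriv_bound_of_le (c := 1 / (C * l ^ 2)) (by positivity) hd hP0 hQ
        (hp1.trans (one_div_le_one_div_of_le (by positivity) hnm)) hp0.le hq0.le hG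
      have e : 4 * (1 / (C * l ^ 2)) * l ^ 2 / (l / 2) ^ 3 = 32 * (C⁻¹ / l ^ 3) := by
        field_simp
        norm_num
      rw [e] at h
      linarith


/-- Estimates on the first few derivatives of `g_t`: there are absolute constants
`c₁, c₂ > 0` such that for every `C > 1` there is `x₀(C)` with the following property.
If `g` is smooth on `{x > 0 : Γ(x+2) ≤ t}` with `g(x) ≥ x` and
`Γ(g(x)+1)/Γ(g(x)-x+1) = t` there, then for all `m ≥ x₀` with `t ≥ x₀` and `Γ(m+2) ≤ t`:
(1) `g(m) ≍ t^{1/m}`; (2) if `m ≤ g(m)/2` then `-g'(m) ≍ g(m)(log t)/m²`;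
(3) if `m ≤ g(m) - C(log g(m))²` then `0 < g''(m) ≤ c₂(g(m)((log t)/m²)² + C⁻¹(log m)⁻³)`. -/
theorem stmt_18 :
    ∃ c₁ > (0 : ℝ), ∃ c₂ > (0 : ℝ), ∀ C : ℝ, 1 < C → ∃ x₀ : ℝ,
      ∀ t : ℝ, ∀ g : ℝ → ℝ,
        ContDiffOn ℝ (⊤ : ℕ∞) g {x : ℝ | 0 < x ∧ Real.Gamma (x + 2) ≤ t} →
        (∀ x : ℝ, 0 < x → Real.Gamma (x + 2) ≤ t →
          x ≤ g x ∧ Real.Gamma (g x + 1) / Real.Gamma (g x - x + 1) = t) →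
        ∀ m : ℝ, x₀ ≤ m → x₀ ≤ t → Real.Gamma (m + 2) ≤ t →
          (c₁ * t ^ (1 / m) ≤ g m ∧ g m ≤ c₂ * t ^ (1 / m)) ∧
          (2 * m ≤ g m →
            c₁ * (g m * Real.log t / m ^ 2) ≤ -deriv g m ∧
            -deriv g m ≤ c₂ * (g m * Real.log t / m ^ 2)) ∧
          (m ≤ g m - C * (Real.log (g m)) ^ 2 →
            0 < deriv (deriv g) m ∧
            deriv (deriv g) m ≤
              c₂ * (g m * (Real.log t / m ^ 2) ^ 2 + C⁻¹ / (Real.log m) ^ 3)) := by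
  refine ⟨1 / 16, by norm_num, 1000, by norm_num, fun C hC => ?_⟩
  obtain ⟨x₀, hx₀, hbig⟩ := exists_forall_log_pow_le C
  refine ⟨x₀, fun t g hg hgt m hm _ hmt => ?_⟩
  have hm100 : 100 ≤ m := hx₀.trans hm
  have hm0 : 0 < m := by linarith
  have ht : 0 < t := (Gamma_pos_of_pos (by linarith : 0 < m + 2)).trans_le hmt
  have hlog : ∀ x : ℝ, 0 < x → Gamma (x + 2) ≤ t →
      x ≤ g x ∧ log (Gamma (g x + 1)) - log (Gamma (g x - x + 1)) = log t := fun x hx hxt => by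
    obtain ⟨h1, h2⟩ := hgt x hx hxt
    refine ⟨h1, ?_⟩
    rw [← h2, log_div (Gamma_pos_of_pos (by linarith)).ne' (Gamma_pos_of_pos (by linarith)).ne']
  obtain ⟨hmn, hT⟩ := hlog m hm0 hmt
  set n := g m with hn_def
  have hn0 : 0 < n := by linarith
  obtain ⟨hl4, hbign⟩ := hbig n (hm.trans hmn)
  set l := log n with hl_def
  set r := log t / m with hr_def
  have hlog2 : log 2 < 1 := by linarith [log_two_lt_d9]
  have hlog_n1 : log (n + 1) ≤ l + log 2 := by
    rw [hl_def, ← log_mul hn0.ne' two_ne_zero]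
    exact log_le_log (by linarith) (by linarith)
  obtain ⟨hlow, hup⟩ := log_Gamma_sub_bounds (by linarith : 1 ≤ m) hmn
  rw [hT] at hlow hup
  have hr1 : l - 1 ≤ r := by rw [hr_def, le_div_iff₀ hm0]; linarith
  have hr2 : r ≤ l + log 2 := by
    rw [hr_def, div_le_iff₀ hm0]
    nlinarith
  have hrt : t ^ (1 / m) = exp r := by
    rw [rpow_def_of_pos ht, hr_def, mul_one_div]
  have hexpl : exp l = n := exp_log hn0
  refine ⟨?_, ?_⟩
  · rw [hrt]
    constructor
    · have : exp r ≤ n * 2 := by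
        refine (exp_le_exp.2 hr2).trans (le_of_eq ?_)
        rw [exp_add, hexpl, exp_log two_pos]
      linarith
    · have : n ≤ exp 1 * exp r := by
        rw [← exp_add, ← hexpl]
        exact exp_le_exp.2 (by linarith)
      nlinarith [exp_one_lt_d9, exp_pos r]
  have interior : m + 1 < n →
      (psi (n + 1) - psi (n - m + 1)) * deriv g m + psi (n - m + 1) = 0 ∧
      (psi (n + 1) - psi (n - m + 1)) * deriv (deriv g) m =
        deriv psi (n - m + 1) * (1 - deriv g m) ^ 2 - deriv psi (n + 1) * deriv g m ^ 2 := by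
    intro h
    have hev := eventually_Gamma_add_two_le hm0
      (Gamma_lt_of_log_Gamma_sub_eq (by linarith) h ht hT)
    have hcd : ContDiffAt ℝ 2 g m := (hg.contDiffAt hev).of_le (WithTop.coe_le_coe.2 (OrderTop.le_top (2 : ℕ∞)))
    have hev' := hev.mono fun y hy => hlog y hy.1 hy.2
    exact ⟨psi_sub_psi_mul_deriv hm0 (hcd.differentiableAt (by norm_num)) hev',
      psi_sub_psi_mul_deriv_deriv hm0 hcd hev'⟩
  refine ⟨fun h2m => ?_, fun hC2 => ?_⟩
  · obtain ⟨hg1, -⟩ := interior (by linarith)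
    obtain ⟨hP1, hP2⟩ := log_le_psi_le_log (by linarith) (by linarith : m < n)
    obtain ⟨hD1, hD2⟩ := psi_sub_psi_bounds_of_two_mul_le (by linarith) h2m
    set P := psi (n - m + 1)
    set D := psi (n + 1) - P
    have hD0 : 0 < D := lt_of_lt_of_le (by positivity) hD1
    have hP3 : l / 2 ≤ P := by
      have h3 : log (n / 2) ≤ log (n - m) := log_le_log (by linarith) (by linarith)
      rw [log_div hn0.ne' two_ne_zero, ← hl_def] at h3
      linarith
    have hgP : -deriv g m = P / D := by
      rw [eq_div_iff hD0.ne']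
      linear_combination -hg1
    have hnr : n * log t / m ^ 2 = n * r / m := by rw [hr_def]; field_simp
    rw [hgP, hnr, le_div_iff₀ hD0, div_le_iff₀ hD0]
    have hr0 : 0 < r := by linarith
    constructor
    · calc 1 / 16 * (n * r / m) * D ≤ 1 / 16 * (n * r / m) * (4 * m / n) :=
            mul_le_mul_of_nonneg_left hD2 (by positivity)
        _ = r / 4 := by field_simp; norm_num
        _ ≤ P := by linarith
    · calc P ≤ 500 * r := by linarith
        _ = 1000 * (n * r / m) * (m / (2 * n)) := by field_simp; norm_num
        _ ≤ 1000 * (n * r / m) * D := mul_le_mul_of_nonneg_left hD1 (by positivity)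
  · obtain ⟨hg1, hg2⟩ := interior (by nlinarith)
    have e : log t / m ^ 2 = r / m := by rw [hr_def]; field_simp
    rw [e]
    exact second_deriv_bounds hC hm100 (by linarith) hl4 hbign hC2 hg1 hg2
end

section
/- For all integers a and b with 2 ≤ b < a, one has ((a)_b)_{(a)_b − a} = ((a)_b − 1)_{(a)_b − a + b − 1}; in particular two distinct falling factorials take the common value t = ((a)_b)_{(a)_b − a} for each such pair (a,b). -/
/-- The infinite family of collisions of falling factorials: for integers `2 ≤ b < a`,
`((a)_b)_{(a)_b - a} = ((a)_b - 1)_{(a)_b - a + b - 1}`, and the two pairs of arguments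
are distinct, so two distinct falling factorials take this common value. -/
theorem stmt_19 (a b : ℕ) (hb : 2 ≤ b) (hba : b < a) :
    Nat.descFactorial (Nat.descFactorial a b) (Nat.descFactorial a b - a) =
      Nat.descFactorial (Nat.descFactorial a b - 1) (Nat.descFactorial a b - a + b - 1) ∧
    (Nat.descFactorial a b, Nat.descFactorial a b - a) ≠
      (Nat.descFactorial a b - 1, Nat.descFactorial a b - a + b - 1) := by
  have hN : a ≤ a.descFactorial b := by
    obtain ⟨n, rfl⟩ : ∃ n, a = n + 1 := ⟨a - 1, by omega⟩
    obtain ⟨k, rfl⟩ : ∃ k, b = k + 1 := ⟨b - 1, by omega⟩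
    rw [Nat.succ_descFactorial_succ]
    exact Nat.le_mul_of_pos_right _ (Nat.descFactorial_pos.2 (by omega))
  have ha := Nat.factorial_mul_descFactorial hba.le
  generalize a.descFactorial b = N at hN ha ⊢
  refine ⟨?_, fun h => ?_⟩
  · have hl := Nat.factorial_mul_descFactorial (Nat.sub_le N a)
    have hr := Nat.factorial_mul_descFactorial (show N - a + b - 1 ≤ N - 1 by omega)
    rw [show N - (N - a) = a by omega] at hl
    rw [show N - 1 - (N - a + b - 1) = a - b by omega] at hr
    have hs := Nat.mul_factorial_pred (show N ≠ 0 by omega)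
    apply Nat.eq_of_mul_eq_mul_left (Nat.factorial_pos a)
    rw [hl, ← hs, ← hr, ← ha]
    ring
  · have := congrArg Prod.fst h
    dsimp only at this
    omega
end
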